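/- Every Abelian periodic group variety is definable in the lattice Com. In particular, for every natural number n > 1, the variety A_n of Abelian groups whose exponent divides n is a definable element of Com. -/

import Mathlib

open FirstOrder

/-! ### Words, identities, and commutative semigroup varieties -/

/-- Semigroup words over the countable alphabet `ℕ`. -/
abbrev SGWord : Type := FreeSemigroup ℕ

/-- A semigroup identity `u = v` is a pair of words. -/
abbrev SGId : Type := SGWord × SGWord

/-- The one-letter word consisting of the letter `n`. -/
def ltr (n : ℕ) : SGWord := FreeSemigroup.of n

/-- `wpow w n` is the word `w^n` (for `n ≥ 1`; by convention `wpow w 0 = w`). -/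
def wpow (w : SGWord) : ℕ → SGWord
  | 0 => w
  | 1 => w
  | n + 2 => wpow w (n + 1) * w

/-- The letter `n` occurs in the word `w`. -/
def OccursIn (n : ℕ) (w : SGWord) : Prop := n = w.head ∨ n ∈ w.tail

/-- A semigroup `S` satisfies the identity `i.1 = i.2` if all evaluations of the two
words in `S` coincide. -/
def SGSatisfies (S : Type) [Semigroup S] (i : SGId) : Prop :=
  ∀ f : ℕ → S, FreeSemigroup.lift f i.1 = FreeSemigroup.lift f i.2

/-- A bundled (nonempty) commutative semigroup. -/
structure ComSG where
  carrier : Type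
  [str : CommSemigroup carrier]
  [instNonempty : Nonempty carrier]

attribute [instance] ComSG.str ComSG.instNonempty

/-- The class of commutative semigroups satisfying every identity in `E`. -/
def modelsOf (E : Set SGId) : Set ComSG := {S | ∀ i ∈ E, SGSatisfies S.carrier i}

/-- The set of identities holding in every member of the class `K`. -/
def theoryOfClass (K : Set ComSG) : Set SGId := {i | ∀ S ∈ K, SGSatisfies S.carrier i}

theorem subset_theoryOfClass_modelsOf (E : Set SGId) : E ⊆ theoryOfClass (modelsOf E) :=
  fun i hi S hS => hS i hi

theorem theoryOfClass_antitone {K K' : Set ComSG} (h : K ⊆ K') :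
    theoryOfClass K' ⊆ theoryOfClass K := fun _ hi S hS => hi S (h hS)

theorem modelsOf_antitone {E E' : Set SGId} (h : E ⊆ E') : modelsOf E' ⊆ modelsOf E :=
  fun _ hS i hi => hS i (h hi)

/-- A variety of commutative semigroups, identified with its (equationally closed)
equational theory.  Varieties are ordered by inclusion of the corresponding classes
of semigroups, i.e. by *reverse* inclusion of theories. -/
structure ComVariety where
  theory : Set SGId
  closed : theoryOfClass (modelsOf theory) = theory

theorem ComVariety.ext' {V W : ComVariety} (h : V.theory = W.theory) : V = W := by
  cases V; cases W; cases h; rfl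

instance : PartialOrder ComVariety where
  le V W := W.theory ⊆ V.theory
  le_refl V := subset_rfl
  le_trans U V W h1 h2 := fun i hi => h1 (h2 hi)
  le_antisymm V W h1 h2 := ComVariety.ext' (subset_antisymm h2 h1)

instance : SupSet ComVariety where
  sSup s :=
    { theory := ⋂ V ∈ s, V.theory
      closed := by
        apply subset_antisymm
        · intro i hi
          refine Set.mem_iInter₂.2 fun V hV => ?_
          have h1 : (⋂ V ∈ s, ComVariety.theory V) ⊆ V.theory := Set.biInter_subset_of_mem hV
          have h2 := theoryOfClass_antitone (modelsOf_antitone h1)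
          rw [V.closed] at h2
          exact h2 hi
        · exact subset_theoryOfClass_modelsOf _ }

/-- The lattice **Com** of all commutative semigroup varieties. -/
instance : CompleteLattice ComVariety :=
  completeLatticeOfSup ComVariety fun s => by
    constructor
    · intro V hV i hi
      exact Set.mem_iInter₂.1 hi V hV
    · intro W hW i hi
      exact Set.mem_iInter₂.2 fun V hV => hW hV hi

/-- The variety of commutative semigroups given by the identity system `E`. -/
def comVar (E : Set SGId) : ComVariety where
  theory := theoryOfClass (modelsOf E)
  closed := by
    apply subset_antisymm
    · exact theoryOfClass_antitone fun S hS i hi => hi S hS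
    · exact subset_theoryOfClass_modelsOf _

/-! ### The first-order language of lattices and definability -/

/-- The first-order language of lattices: two binary function symbols (`true` for the
join `∨` and `false` for the meet `∧`) and nothing else. -/
def latticeLang : Language where
  Functions := fun n => match n with | 2 => Bool | _ => Empty
  Relations := fun _ => Empty

instance latticeLangStructure (L : Type*) [Lattice L] : latticeLang.Structure L where
  funMap {n} f x :=
    match n, f with
    | 2, b => bif b then x 0 ⊔ x 1 else x 0 ⊓ x 1
    | 0, f => f.elim
    | 1, f => f.elim
    | (_ + 3), f => f.elim
  RelMap {n} r _ := r.elim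

/-- A subset `A` of a lattice `L` is definable in `L` if there is a first-order formula
`φ(x)` with one free variable in the language of the lattice operations `∨` and `∧`
such that for every `a ∈ L`, `φ(a)` holds in `L` if and only if `a ∈ A`. -/
def LatDefinable (L : Type*) [Lattice L] (A : Set L) : Prop :=
  ∃ φ : latticeLang.Formula (Fin 1), ∀ a : L, (φ.Realize fun _ => a) ↔ a ∈ A

/-! ### Named varieties -/

/-- The commutativity identity `xy = yx`. -/
def commId : SGId := (ltr 0 * ltr 1, ltr 1 * ltr 0)

/-- The pair of identities abbreviated by the symbolic identity `w = 0`, namely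
`wx = w` and `xw = w`, where `x` is the letter `n` (assumed not to occur in `w`). -/
def zeroId (w : SGWord) (n : ℕ) : Set SGId := {(w * ltr n, w), (ltr n * w, w)}

/-- `A n = var{xⁿy = y, xy = yx}`, the variety of Abelian groups of exponent dividing `n`. -/
def Avar (n : ℕ) : ComVariety := comVar {(wpow (ltr 0) n * ltr 1, ltr 1), commId}

/-- `SL = var{x² = x, xy = yx}`, the variety of semilattices. -/
def SLvar : ComVariety := comVar {(wpow (ltr 0) 2, ltr 0), commId}

/-- `ZM = var{xy = 0}` (within **Com**), the variety of null semigroups. -/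
def ZMvar : ComVariety := comVar ({commId} ∪ zeroId (ltr 0 * ltr 1) 2)

/-- `T = var{x = y}`, the trivial variety. -/
def Tvar : ComVariety := comVar {(ltr 0, ltr 1)}

/-- `COM`, the variety of all commutative semigroups. -/
def COMvar : ComVariety := comVar {commId}

/-- `C m = var{xᵐ = xᵐ⁺¹, xy = yx}` (the variety generated by the cyclic monoid
`⟨a ∣ aᵐ = aᵐ⁺¹⟩`), with the convention `C 0 = T`. -/
def Cvar : ℕ → ComVariety
  | 0 => Tvar
  | m + 1 => comVar {(wpow (ltr 0) (m + 1), wpow (ltr 0) (m + 2)), commId}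

/-- `D m = var{xᵐ = 0, xy = yx}`. -/
def Dvar (m : ℕ) : ComVariety := comVar ({commId} ∪ zeroId (wpow (ltr 0) m) 1)

/-- The word `x₁x₂⋯x_k` (in the letters `0, 1, …, k-1`), for `k ≥ 1`. -/
def chainWord : ℕ → SGWord
  | 0 => ltr 0
  | 1 => ltr 0
  | k + 2 => chainWord (k + 1) * ltr (k + 1)

/-- `N k = var{x² = x₁x₂⋯x_k = 0, xy = yx}`. -/
def Nvar (k : ℕ) : ComVariety :=
  comVar ({commId} ∪ zeroId (wpow (ltr 0) 2) 1 ∪ zeroId (chainWord k) k)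

/-- `N_ω = var{x² = 0, xy = yx}`. -/
def Nomegavar : ComVariety := comVar ({commId} ∪ zeroId (wpow (ltr 0) 2) 1)

/-- `N₃ᶜ = var{xyz = 0, xy = yx}`. -/
def N3cvar : ComVariety := comVar ({commId} ∪ zeroId (ltr 0 * ltr 1 * ltr 2) 3)

/-! ### Semantic notions -/

/-- A semigroup `S` belongs to the variety `V` if it satisfies every identity of `V`. -/
def VMem (S : Type) [Semigroup S] (V : ComVariety) : Prop :=
  ∀ i ∈ V.theory, SGSatisfies S i

/-- `spow a n` is the power `aⁿ` in a semigroup (for `n ≥ 1`; by convention `spow a 0 = a`). -/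
def spow {S : Type} [Semigroup S] (a : S) : ℕ → S
  | 0 => a
  | 1 => a
  | n + 2 => spow a (n + 1) * a

/-- A semigroup is a group. -/
def IsGroupSG (S : Type) [Semigroup S] : Prop :=
  ∃ e : S, (∀ a, e * a = a ∧ a * e = a) ∧ ∀ a, ∃ b, a * b = e ∧ b * a = e

/-- A semigroup is periodic: every element generates a finite cyclic subsemigroup. -/
def IsPeriodicSG (S : Type) [Semigroup S] : Prop :=
  ∀ a : S, ∃ i j : ℕ, 1 ≤ i ∧ i < j ∧ spow a i = spow a j

/-- A semigroup is a nil-semigroup: it has a zero element and every element has a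
power equal to zero. -/
def IsNilSG (S : Type) [Semigroup S] : Prop :=
  ∃ z : S, (∀ a, z * a = z ∧ a * z = z) ∧ ∀ a, ∃ n, 1 ≤ n ∧ spow a n = z

/-- A variety all of whose members are groups. -/
def IsGroupVariety (V : ComVariety) : Prop := ∀ S ∈ modelsOf V.theory, IsGroupSG S.carrier

/-- A variety all of whose members are periodic semigroups. -/
def IsPeriodicVariety (V : ComVariety) : Prop := ∀ S ∈ modelsOf V.theory, IsPeriodicSG S.carrier

/-- A nil-variety: a variety all of whose members are nil-semigroups. -/
def IsNilVariety (V : ComVariety) : Prop := ∀ S ∈ modelsOf V.theory, IsNilSG S.carrier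

/-- A combinatorial variety: all groups in it are trivial. -/
def IsCombinatorial (V : ComVariety) : Prop :=
  ∀ S ∈ modelsOf V.theory, IsGroupSG S.carrier → ∀ a b : S.carrier, a = b

/-- `K` is the variety generated by the semigroup `M` (with explicit semigroup
structure `inst`): the smallest variety containing `M`. -/
def GeneratedBy (M : Type) (inst : Semigroup M) (K : ComVariety) : Prop :=
  IsLeast {W : ComVariety | ∀ i ∈ W.theory, @SGSatisfies M inst i} K

/-- A neutral element of a lattice. -/
def IsNeutralElt {α : Type*} [Lattice α] (x : α) : Prop :=
  ∀ y z, (x ⊔ y) ⊓ (y ⊔ z) ⊓ (z ⊔ x) = (x ⊓ y) ⊔ (y ⊓ z) ⊔ (z ⊓ x)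

/-- A chain variety: a variety whose lattice of subvarieties is a chain. -/
def IsChainVariety (V : ComVariety) : Prop :=
  ∀ W₁ W₂ : ComVariety, W₁ ≤ V → W₂ ≤ V → W₁ ≤ W₂ ∨ W₂ ≤ W₁

/-- A variety is 0-reduced in **Com** if it is given within `COM` by 0-reduced
identities (identities of the form `w = 0`) only. -/
def IsZeroReduced (V : ComVariety) : Prop :=
  ∃ P : Set (SGWord × ℕ), (∀ p ∈ P, ¬ OccursIn p.2 p.1) ∧
    V = comVar (⋃ p ∈ P, zeroId p.1 p.2)

/-- `ZR V`: the least variety 0-reduced in **Com** that contains `V`. -/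
def ZRv (V : ComVariety) : ComVariety := sInf {W : ComVariety | IsZeroReduced W ∧ V ≤ W}

/-! ### Definable predicates of a lattice -/

/-- The function symbol of the join. -/
def supSymbol : latticeLang.Functions 2 := true

/-- A predicate on valuations that is expressed by a formula in the language of lattices. -/
def FODef {L : Type*} [Lattice L] {α : Type} (P : (α → L) → Prop) : Prop :=
  ∃ φ : latticeLang.Formula α, ∀ v, φ.Realize v ↔ P v

/-- A function on valuations that is expressed by a lattice term. -/
def FOTerm {L : Type*} [Lattice L] {α : Type} (t : (α → L) → L) : Prop :=
  ∃ τ : latticeLang.Term α, ∀ v, τ.realize v = t v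

/-- A unary predicate of a lattice expressed by a formula with one free variable. -/
def FODef₁ {L : Type*} [Lattice L] (P : L → Prop) : Prop :=
  FODef fun v : Fin 1 → L => P (v 0)

namespace FODef

variable {L : Type*} [Lattice L] {α : Type}

theorem var (i : α) : FOTerm fun v : α → L => v i := ⟨.var i, fun _ => rfl⟩

theorem sup {s t : (α → L) → L} (hs : FOTerm s) (ht : FOTerm t) :
    FOTerm fun v => s v ⊔ t v := by
  obtain ⟨σ, hσ⟩ := hs
  obtain ⟨τ, hτ⟩ := ht
  refine ⟨supSymbol.apply₂ σ τ, fun v => ?_⟩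
  have h : (supSymbol.apply₂ σ τ).realize v = σ.realize v ⊔ τ.realize v :=
    Language.Term.realize_functions_apply₂
  rw [h, hσ, hτ]

theorem eq {s t : (α → L) → L} (hs : FOTerm s) (ht : FOTerm t) :
    FODef fun v => s v = t v := by
  obtain ⟨σ, hσ⟩ := hs
  obtain ⟨τ, hτ⟩ := ht
  refine ⟨σ.equal τ, fun v => ?_⟩
  rw [Language.Formula.realize_equal, hσ, hτ]

theorem congr {P Q : (α → L) → Prop} (hP : FODef P) (h : ∀ v, P v ↔ Q v) : FODef Q := by
  obtain ⟨φ, hφ⟩ := hP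
  exact ⟨φ, fun v => (hφ v).trans (h v)⟩

theorem le {s t : (α → L) → L} (hs : FOTerm s) (ht : FOTerm t) :
    FODef fun v => s v ≤ t v :=
  (eq (sup hs ht) ht).congr fun _ => sup_eq_right

theorem and {P Q : (α → L) → Prop} (hP : FODef P) (hQ : FODef Q) :
    FODef fun v => P v ∧ Q v := by
  obtain ⟨φ, hφ⟩ := hP
  obtain ⟨ψ, hψ⟩ := hQ
  exact ⟨φ ⊓ ψ, fun v => by rw [Language.Formula.realize_inf, hφ, hψ]⟩

theorem not {P : (α → L) → Prop} (hP : FODef P) : FODef fun v => ¬ P v := by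
  obtain ⟨φ, hφ⟩ := hP
  exact ⟨φ.not, fun v => by rw [Language.Formula.realize_not, hφ]⟩

theorem or {P Q : (α → L) → Prop} (hP : FODef P) (hQ : FODef Q) :
    FODef fun v => P v ∨ Q v :=
  (hP.not.and hQ.not).not.congr fun v => by tauto

theorem imp {P Q : (α → L) → Prop} (hP : FODef P) (hQ : FODef Q) :
    FODef fun v => P v → Q v :=
  (hP.and hQ.not).not.congr fun v => by tauto

theorem ex {P : (α → L) → L → Prop}
    (h : FODef fun v : α ⊕ Fin 1 → L => P (fun i => v (.inl i)) (v (.inr 0))) :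
    FODef fun v => ∃ a, P v a := by
  obtain ⟨φ, hφ⟩ := h
  refine ⟨φ.iExs (Fin 1), fun v => ?_⟩
  rw [Language.Formula.realize_iExs]
  constructor
  · rintro ⟨i, hi⟩
    exact ⟨i 0, (hφ _).1 hi⟩
  · rintro ⟨a, ha⟩
    exact ⟨fun _ => a, (hφ _).2 ha⟩

theorem all {P : (α → L) → L → Prop}
    (h : FODef fun v : α ⊕ Fin 1 → L => P (fun i => v (.inl i)) (v (.inr 0))) :
    FODef fun v => ∀ a, P v a :=
  (ex (P := fun v a => ¬ P v a) h.not).not.congr fun v => by simp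

end FODef

theorem FODef₁.at {L : Type*} [Lattice L] {α : Type} {P : L → Prop} (h : FODef₁ P) (i : α) :
    FODef fun v : α → L => P (v i) := by
  obtain ⟨φ, hφ⟩ := h
  refine ⟨φ.relabel fun _ => i, fun v => ?_⟩
  rw [Language.Formula.realize_relabel]
  exact hφ _

/-! ### Lattice-theoretic notions singling out group and nil-varieties -/

/-- There is a strictly increasing chain of `k + 1` elements ending in `x`. -/
def HeightGE {L : Type*} [Lattice L] : ℕ → L → Prop
  | 0, _ => True
  | k + 1, x => ∃ y, ¬ x ≤ y ∧ y ≤ x ∧ HeightGE k y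

open FODef in
theorem fodef_heightGE {L : Type*} [Lattice L] (k : ℕ) : FODef₁ fun x : L => HeightGE k x := by
  induction k with
  | zero => exact (eq (var 0) (var 0)).congr fun _ => by simp [HeightGE]
  | succ k ih =>
    exact ex ((le (var _) (var _)).not.and ((le (var _) (var _)).and (ih.at _)))

section LatticeNotions

variable {L : Type*} [Lattice L] [OrderBot L]

/-- Every atom below `v` equals `x`. -/
def SoleAtom (x v : L) : Prop := ∀ y, IsAtom y → y ≤ v → y = x

/-- The lattice property characterizing the semilattice variety. -/
def SLLike (x : L) : Prop := IsAtom x ∧ ∀ v, SoleAtom x v → v ≤ x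

/-- The lattice property characterizing the variety of null semigroups. -/
def ZMLike (x : L) : Prop :=
  IsAtom x ∧ ∃ v w, SoleAtom x v ∧ SoleAtom x w ∧ ¬ v ≤ w ∧ ¬ w ≤ v

/-- The lattice property characterizing nil-varieties. -/
def NilLike (v : L) : Prop := ∀ y, IsAtom y → y ≤ v → ZMLike y

/-- The lattice property characterizing periodic group varieties. -/
def AbGroupLike (v : L) : Prop := ∀ y, IsAtom y → y ≤ v → ¬ ZMLike y ∧ ¬ SLLike y

/-- A nil-like element whose lower elements form a chain. -/
def NilChain (x : L) : Prop :=
  NilLike x ∧ ∀ v, v ≤ x → ∀ w, w ≤ x → v ≤ w ∨ w ≤ v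

/-- The lattice property that compares the exponent of a group variety with `k`. -/
def ExponentLT (k : ℕ) (g : L) : Prop :=
  ∃ y, NilLike y ∧ ∃ z, NilLike z ∧ (∀ c, NilChain c → HeightGE k c → ¬ c ≤ z) ∧
    ¬ z ≤ g ⊔ y ∧ ∃ h, AbGroupLike h ∧ z ≤ h ⊔ y

open FODef

theorem fodef_isAtom : FODef₁ fun x : L => IsAtom x := by
  have h : FODef₁ fun x : L => (∃ y, ¬ x ≤ y) ∧ ∀ y, y ≤ x → ¬ x ≤ y → ∀ z, y ≤ z :=
    (ex (le (var _) (var _)).not).and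
      (all ((le (var _) (var _)).imp ((le (var _) (var _)).not.imp (all (le (var _) (var _))))))
  refine h.congr fun v => ?_
  generalize v 0 = x
  constructor
  · rintro ⟨⟨y, hy⟩, h⟩
    refine ⟨fun h0 => hy (h0 ▸ bot_le), fun y hy => ?_⟩
    exact le_bot_iff.1 (h y hy.le hy.not_ge ⊥)
  · rintro ⟨h0, h⟩
    refine ⟨⟨⊥, fun h1 => h0 (le_bot_iff.1 h1)⟩, fun y hy hy' z => ?_⟩
    rw [h y (lt_of_le_not_ge hy hy')]
    exact bot_le

theorem fodef_soleAtom {α : Type} (i j : α) : FODef fun v : α → L => SoleAtom (v i) (v j) :=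
  all ((fodef_isAtom.at _).imp ((le (var _) (var _)).imp (eq (var _) (var _))))

theorem fodef_slLike : FODef₁ fun x : L => SLLike x :=
  (fodef_isAtom.at _).and (all ((fodef_soleAtom _ _).imp (le (var _) (var _))))

theorem fodef_zmLike : FODef₁ fun x : L => ZMLike x :=
  (fodef_isAtom.at _).and (ex (ex ((fodef_soleAtom _ _).and ((fodef_soleAtom _ _).and
    ((le (var _) (var _)).not.and (le (var _) (var _)).not)))))

theorem fodef_nilLike : FODef₁ fun x : L => NilLike x :=
  all ((fodef_isAtom.at _).imp ((le (var _) (var _)).imp (fodef_zmLike.at _)))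

theorem fodef_abGroupLike : FODef₁ fun x : L => AbGroupLike x :=
  all ((fodef_isAtom.at _).imp ((le (var _) (var _)).imp
    ((fodef_zmLike.at _).not.and (fodef_slLike.at _).not)))

theorem fodef_nilChain : FODef₁ fun x : L => NilChain x :=
  (fodef_nilLike.at _).and (all ((le (var _) (var _)).imp (all ((le (var _) (var _)).imp
    ((le (var _) (var _)).or (le (var _) (var _)))))))

theorem fodef_exponentLT (k : ℕ) : FODef₁ fun x : L => ExponentLT k x :=
  ex ((fodef_nilLike.at _).and (ex ((fodef_nilLike.at _).and
    ((all ((fodef_nilChain.at _).imp (((fodef_heightGE k).at _).imp (le (var _) (var _)).not))).and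
      ((le (var _) (sup (var _) (var _))).not.and
        (ex ((fodef_abGroupLike.at _).and (le (var _) (sup (var _) (var _))))))))))

end LatticeNotions

/-! ### Exponent vectors of words -/

open Finsupp (single degree linearCombination)

/-- The exponent vector of a word. -/
noncomputable def expVec (w : SGWord) : ℕ →₀ ℕ :=
  Multiplicative.toAdd (FreeSemigroup.lift (fun i => Multiplicative.ofAdd (single i 1)) w)

theorem expVec_mul (u v : SGWord) : expVec (u * v) = expVec u + expVec v := by
  simp [expVec]

theorem expVec_of (i : ℕ) : expVec (FreeSemigroup.of i) = single i 1 := rfl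

theorem expVec_ne_zero (w : SGWord) : expVec w ≠ 0 := by
  induction w using FreeSemigroup.recOnMul with
  | ih1 i => simp [expVec_of]
  | ih2 i w _ hw => simpa [expVec_mul] using fun _ => hw

theorem exists_expVec_eq {a : ℕ →₀ ℕ} (ha : a ≠ 0) : ∃ w, expVec w = a := by
  suffices h : a = 0 ∨ ∃ w, expVec w = a from h.resolve_left ha
  clear ha
  induction a using Finsupp.induction_linear with
  | zero => exact .inl rfl
  | add a b ha hb =>
    rcases ha with rfl | ⟨u, rfl⟩
    · simpa using hb
    rcases hb with rfl | ⟨v, rfl⟩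
    · exact .inr ⟨u, by simp⟩
    exact .inr ⟨u * v, expVec_mul u v⟩
  | single i k =>
    induction k with
    | zero => simp
    | succ k ih =>
      right
      rcases ih with h | ⟨u, hu⟩
      · refine ⟨.of i, ?_⟩
        rw [Finsupp.single_add, h, zero_add, expVec_of]
      · exact ⟨u * .of i, by rw [expVec_mul, hu, expVec_of, Finsupp.single_add]⟩

theorem coe_lift_eq_prod {S : Type} [CommSemigroup S] (f : ℕ → S) (w : SGWord) :
    (FreeSemigroup.lift f w : WithOne S) =
      (expVec w).prod fun i k => (f i : WithOne S) ^ k := by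
  induction w using FreeSemigroup.recOnMul with
  | ih1 i => simp [expVec_of]
  | ih2 i w hi hw =>
    rw [map_mul, WithOne.coe_mul, hi, hw, expVec_mul, Finsupp.prod_add_index']
    · simp
    · intro i m n
      exact pow_add _ _ _

theorem lift_eq_of_expVec_eq {S : Type} [CommSemigroup S] (f : ℕ → S) {u v : SGWord}
    (h : expVec u = expVec v) : FreeSemigroup.lift f u = FreeSemigroup.lift f v := by
  rw [← WithOne.coe_inj, coe_lift_eq_prod, coe_lift_eq_prod, h]

theorem lift_lift {S : Type} [Semigroup S] (f : ℕ → S) (s : ℕ → SGWord) (w : SGWord) :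
    FreeSemigroup.lift f (FreeSemigroup.lift s w) =
      FreeSemigroup.lift (fun i => FreeSemigroup.lift f (s i)) w := by
  induction w using FreeSemigroup.recOnMul with
  | ih1 i => simp
  | ih2 i w hi hw => rw [map_mul, map_mul, map_mul, hi, hw]

theorem expVec_lift (s : ℕ → SGWord) (w : SGWord) :
    expVec (FreeSemigroup.lift s w) = linearCombination ℕ (fun i => expVec (s i)) (expVec w) := by
  induction w using FreeSemigroup.recOnMul with
  | ih1 i => simp [expVec_of]
  | ih2 i w hi hw => rw [map_mul, expVec_mul, expVec_mul, map_add, hi, hw]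

/-! ### Varieties as fully invariant congruences on exponent vectors -/

/-- The identity with exponent vectors `a` and `b` holds in the variety `V`. -/
def ComVariety.Rel (V : ComVariety) (a b : ℕ →₀ ℕ) : Prop :=
  ∃ u v, expVec u = a ∧ expVec v = b ∧ (u, v) ∈ V.theory

namespace ComVariety

variable {V W : ComVariety} {a b c : ℕ →₀ ℕ}

theorem mem_theory_iff {i : SGId} :
    i ∈ V.theory ↔ ∀ S ∈ modelsOf V.theory, SGSatisfies S.carrier i := by
  conv_lhs => rw [← V.closed]
  rfl

theorem rel_expVec {u v : SGWord} : V.Rel (expVec u) (expVec v) ↔ (u, v) ∈ V.theory := by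
  refine ⟨?_, fun h => ⟨u, v, rfl, rfl, h⟩⟩
  rintro ⟨u', v', hu, hv, h⟩
  rw [mem_theory_iff] at h ⊢
  intro S hS f
  have := h S hS f
  rwa [lift_eq_of_expVec_eq f hu, lift_eq_of_expVec_eq f hv] at this

theorem le_iff_rel : V ≤ W ↔ ∀ a b, W.Rel a b → V.Rel a b := by
  constructor
  · rintro h _ _ ⟨u, v, rfl, rfl, huv⟩
    exact ⟨u, v, rfl, rfl, h huv⟩
  · rintro h ⟨u, v⟩ huv
    exact rel_expVec.1 (h _ _ (rel_expVec.2 huv))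

theorem not_le_iff_rel : ¬ V ≤ W ↔ ∃ a b, W.Rel a b ∧ ¬ V.Rel a b := by
  rw [le_iff_rel]
  push Not
  rfl

theorem theory_sup : (V ⊔ W).theory = V.theory ∩ W.theory := by
  have h : V ⊔ W = sSup {V, W} := by rw [sSup_pair]
  have h' : (sSup {V, W} : ComVariety).theory = ⋂ U ∈ ({V, W} : Set ComVariety), U.theory := rfl
  rw [h, h', Set.biInter_pair]

theorem rel_sup : (V ⊔ W).Rel a b ↔ V.Rel a b ∧ W.Rel a b := by
  constructor
  · rintro ⟨u, v, rfl, rfl, h⟩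
    rw [theory_sup] at h
    exact ⟨rel_expVec.2 h.1, rel_expVec.2 h.2⟩
  · rintro ⟨⟨u, v, rfl, rfl, h⟩, h'⟩
    rw [rel_expVec] at h' ⊢
    rw [theory_sup]
    exact ⟨h, h'⟩

namespace Rel

theorem ne_zero_left (h : V.Rel a b) : a ≠ 0 := by
  obtain ⟨u, v, rfl, rfl, -⟩ := h
  exact expVec_ne_zero u

theorem ne_zero_right (h : V.Rel a b) : b ≠ 0 := by
  obtain ⟨u, v, rfl, rfl, -⟩ := h
  exact expVec_ne_zero v

theorem refl (ha : a ≠ 0) : V.Rel a a := by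
  obtain ⟨u, rfl⟩ := exists_expVec_eq ha
  rw [rel_expVec, mem_theory_iff]
  exact fun _ _ _ => rfl

theorem symm (h : V.Rel a b) : V.Rel b a := by
  obtain ⟨u, v, rfl, rfl, h⟩ := h
  rw [mem_theory_iff] at h
  rw [rel_expVec, mem_theory_iff]
  exact fun S hS f => (h S hS f).symm

theorem trans (h : V.Rel a b) (h' : V.Rel b c) : V.Rel a c := by
  obtain ⟨u, v, rfl, rfl, h⟩ := h
  obtain ⟨w, hw⟩ := exists_expVec_eq h'.ne_zero_right
  rw [← hw, rel_expVec, mem_theory_iff] at h' ⊢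
  rw [mem_theory_iff] at h
  exact fun S hS f => (h S hS f).trans (h' S hS f)

theorem add_right (h : V.Rel a b) (c : ℕ →₀ ℕ) : V.Rel (a + c) (b + c) := by
  rcases eq_or_ne c 0 with rfl | hc
  · simpa using h
  obtain ⟨u, v, rfl, rfl, h⟩ := h
  obtain ⟨w, rfl⟩ := exists_expVec_eq hc
  rw [mem_theory_iff] at h
  rw [← expVec_mul, ← expVec_mul, rel_expVec, mem_theory_iff]
  intro S hS f
  simp only [map_mul]
  rw [h S hS f]

theorem add_left (h : V.Rel a b) (c : ℕ →₀ ℕ) : V.Rel (c + a) (c + b) := by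
  simpa only [add_comm] using h.add_right c

theorem subst (h : V.Rel a b) {σ : ℕ → ℕ →₀ ℕ} (hσ : ∀ i, σ i ≠ 0) :
    V.Rel (linearCombination ℕ σ a) (linearCombination ℕ σ b) := by
  choose s hs using fun i => exists_expVec_eq (hσ i)
  obtain rfl : (fun i => expVec (s i)) = σ := funext hs
  obtain ⟨u, v, rfl, rfl, h⟩ := h
  rw [mem_theory_iff] at h
  rw [← expVec_lift, ← expVec_lift, rel_expVec, mem_theory_iff]
  intro S hS f
  simp only [lift_lift]
  exact h S hS _

end Rel

theorem eq_bot_of_rel (h : ∀ a b : ℕ →₀ ℕ, a ≠ 0 → b ≠ 0 → V.Rel a b) : V = ⊥ :=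
  le_bot_iff.1 (le_iff_rel.2 fun a b hab => h a b hab.ne_zero_left hab.ne_zero_right)

end ComVariety

/-- A fully invariant congruence on exponent vectors. -/
structure IsFullyInvariant (r : (ℕ →₀ ℕ) → (ℕ →₀ ℕ) → Prop) : Prop where
  refl : ∀ a, r a a
  symm : ∀ {a b}, r a b → r b a
  trans : ∀ {a b c}, r a b → r b c → r a c
  add_right : ∀ {a b}, r a b → ∀ c, r (a + c) (b + c)
  subst : ∀ {a b}, r a b → ∀ σ : ℕ → ℕ →₀ ℕ, (∀ i, σ i ≠ 0) →
    r (linearCombination ℕ σ a) (linearCombination ℕ σ b)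

namespace IsFullyInvariant

variable {r : (ℕ →₀ ℕ) → (ℕ →₀ ℕ) → Prop} (hr : IsFullyInvariant r)

/-- The congruence on words induced by a fully invariant congruence. -/
def wordCon : Con SGWord where
  r u v := r (expVec u) (expVec v)
  iseqv := ⟨fun _ => hr.refl _, hr.symm, hr.trans⟩
  mul' {w x y z} h h' := by
    rw [expVec_mul, expVec_mul]
    have := hr.add_right h' (expVec x)
    rw [add_comm, add_comm (expVec z)] at this
    exact hr.trans (hr.add_right h _) this

instance : CommSemigroup hr.wordCon.Quotient where
  mul_comm x y := by
    induction x using Con.induction_on with | _ u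
    induction y using Con.induction_on with | _ v
    rw [← Con.coe_mul, ← Con.coe_mul, Con.eq]
    change r _ _
    rw [expVec_mul, expVec_mul, add_comm]
    exact hr.refl _

theorem lift_coe (s : ℕ → SGWord) (w : SGWord) :
    FreeSemigroup.lift (fun i => (s i : hr.wordCon.Quotient)) w =
      (FreeSemigroup.lift s w : SGWord) := by
  induction w using FreeSemigroup.recOnMul with
  | ih1 i => simp
  | ih2 i w hi hw => rw [map_mul, map_mul, Con.coe_mul, hi, hw]

/-- The relatively free semigroup of a fully invariant congruence. -/
def freeModel : ComSG :=
  haveI : Nonempty hr.wordCon.Quotient := ⟨((FreeSemigroup.of 0 : SGWord) : hr.wordCon.Quotient)⟩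
  ⟨hr.wordCon.Quotient⟩

theorem satisfies_freeModel {u v : SGWord} :
    SGSatisfies hr.freeModel.carrier (u, v) ↔ r (expVec u) (expVec v) := by
  change (∀ f : ℕ → hr.wordCon.Quotient, _) ↔ _
  constructor
  · intro h
    have h' := (Con.eq hr.wordCon).1 (((hr.lift_coe FreeSemigroup.of u).symm.trans
      (h _)).trans (hr.lift_coe FreeSemigroup.of v))
    have hid : ∀ w : SGWord, FreeSemigroup.lift FreeSemigroup.of w = w := fun w =>
      DFunLike.congr_fun (FreeSemigroup.lift_comp_of' (MulHom.id SGWord)) w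
    rw [hid, hid] at h'
    exact h'
  · intro h f
    choose s hs using fun i => Quotient.exists_rep (s := hr.wordCon.toSetoid) (f i)
    obtain rfl : (fun i => ((s i : SGWord) : hr.wordCon.Quotient)) = f := funext hs
    refine ((hr.lift_coe s u).trans ((Con.eq hr.wordCon).2 ?_)).trans (hr.lift_coe s v).symm
    change r _ _
    rw [expVec_lift, expVec_lift]
    exact hr.subst h _ fun i => expVec_ne_zero _

/-- The variety whose identities are given by a fully invariant congruence. -/
def toVariety : ComVariety where
  theory := {i | r (expVec i.1) (expVec i.2)}
  closed := by
    refine subset_antisymm (fun i hi => ?_) (subset_theoryOfClass_modelsOf _)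
    exact hr.satisfies_freeModel.1 (hi hr.freeModel fun j hj => hr.satisfies_freeModel.2 hj)

theorem rel_toVariety {a b : ℕ →₀ ℕ} : hr.toVariety.Rel a b ↔ a ≠ 0 ∧ b ≠ 0 ∧ r a b := by
  constructor
  · rintro ⟨u, v, rfl, rfl, h⟩
    exact ⟨expVec_ne_zero u, expVec_ne_zero v, h⟩
  · rintro ⟨ha, hb, h⟩
    obtain ⟨u, rfl⟩ := exists_expVec_eq ha
    obtain ⟨v, rfl⟩ := exists_expVec_eq hb
    exact ⟨u, v, rfl, rfl, h⟩

end IsFullyInvariant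

/-! ### Substitutions into exponent vectors -/

section Substitution

variable (σ : ℕ → ℕ →₀ ℕ) (a : ℕ →₀ ℕ)

theorem linearCombination_nat_apply (j : ℕ) :
    linearCombination ℕ σ a j = a.sum fun i k => k * σ i j := by
  simp [Finsupp.linearCombination_apply, Finsupp.sum, Finsupp.finsetSum_apply]

theorem degree_linearCombination :
    (linearCombination ℕ σ a).degree = a.sum fun i k => k * (σ i).degree := by
  simp [Finsupp.linearCombination_apply, Finsupp.sum, map_sum]

theorem mul_le_linearCombination_apply (i j : ℕ) : a i * σ i j ≤ linearCombination ℕ σ a j := by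
  rw [linearCombination_nat_apply]
  by_cases h : a i = 0
  · simp [h]
  · exact Finset.single_le_sum (f := fun i => a i * σ i j) (fun _ _ => Nat.zero_le _)
      (Finsupp.mem_support_iff.2 h)

theorem mem_support_linearCombination {j : ℕ} :
    j ∈ (linearCombination ℕ σ a).support ↔ ∃ i ∈ a.support, j ∈ (σ i).support := by
  rw [Finsupp.mem_support_iff, linearCombination_nat_apply, Finsupp.sum, ne_eq,
    Finset.sum_eq_zero_iff]
  push Not
  refine exists_congr fun i => and_congr_right fun hi => ?_
  simp [Finsupp.mem_support_iff.1 hi]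

variable {σ a}

theorem one_le_degree {c : ℕ →₀ ℕ} (hc : c ≠ 0) : 1 ≤ c.degree :=
  Nat.one_le_iff_ne_zero.2 fun h => hc ((Finsupp.degree_eq_zero_iff c).1 h)

theorem degree_le_degree_linearCombination (hσ : ∀ i, σ i ≠ 0) :
    a.degree ≤ (linearCombination ℕ σ a).degree := by
  rw [degree_linearCombination, Finsupp.degree_apply]
  exact Finset.sum_le_sum fun i _ => Nat.le_mul_of_pos_right _ (one_le_degree (hσ i))

/-- If every letter of `a` is replaced by `c`, the result is a multiple of `c`. -/
theorem linearCombination_const {c : ℕ →₀ ℕ} (h : ∀ i ∈ a.support, σ i = c) :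
    linearCombination ℕ σ a = a.degree • c := by
  rw [Finsupp.linearCombination_apply, Finsupp.sum, Finsupp.degree_apply, Finset.sum_smul]
  exact Finset.sum_congr rfl fun i hi => by rw [h i hi]

/-- The substitution that sends the letter `i` to `c` and all other letters to `e`. -/
noncomputable def twoSubst (i : ℕ) (c e : ℕ →₀ ℕ) (j : ℕ) : ℕ →₀ ℕ := if j = i then c else e

theorem twoSubst_ne_zero {i : ℕ} {c e : ℕ →₀ ℕ} (hc : c ≠ 0) (he : e ≠ 0) (j : ℕ) :
    twoSubst i c e j ≠ 0 := by
  unfold twoSubst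
  split_ifs <;> assumption

theorem linearCombination_twoSubst (i : ℕ) (c e : ℕ →₀ ℕ) :
    linearCombination ℕ (twoSubst i c e) a = a i • c + (a.erase i).degree • e := by
  conv_lhs => rw [← Finsupp.single_add_erase i a]
  rw [map_add, Finsupp.linearCombination_single, linearCombination_const (c := e)]
  · simp [twoSubst]
  · intro j hj
    simp only [Finsupp.support_erase, Finset.mem_erase] at hj
    simp [twoSubst, hj.1]

theorem apply_add_degree_erase (i : ℕ) : a i + (a.erase i).degree = a.degree := by
  conv_rhs => rw [← Finsupp.single_add_erase i a]
  simp

end Substitution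

/-! ### Some particular varieties -/

theorem isFullyInvariant_ideal {I : (ℕ →₀ ℕ) → Prop} (hadd : ∀ a c, I a → I (a + c))
    (hsubst : ∀ a σ, (∀ i, σ i ≠ 0) → I a → I (linearCombination ℕ σ a)) :
    IsFullyInvariant fun a b => a = b ∨ I a ∧ I b where
  refl _ := .inl rfl
  symm := by tauto
  trans := by
    rintro a b c (rfl | ⟨h1, h2⟩) (rfl | ⟨h3, h4⟩) <;> tauto
  add_right := by
    rintro a b (rfl | ⟨ha, hb⟩) c
    · exact .inl rfl
    · exact .inr ⟨hadd _ _ ha, hadd _ _ hb⟩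
  subst := by
    rintro a b (rfl | ⟨ha, hb⟩) σ hσ
    · exact .inl rfl
    · exact .inr ⟨hsubst _ _ hσ ha, hsubst _ _ hσ hb⟩

theorem isFullyInvariant_degree (k : ℕ) :
    IsFullyInvariant fun a b => a = b ∨ k ≤ a.degree ∧ k ≤ b.degree :=
  isFullyInvariant_ideal (fun a c h => by rw [map_add]; exact h.trans (Nat.le_add_right _ _))
    fun _ _ hσ h => h.trans (degree_le_degree_linearCombination hσ)

/-- The variety in which all words of length at least `k` are zero. -/
noncomputable def nilpVariety (k : ℕ) : ComVariety := (isFullyInvariant_degree k).toVariety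

theorem isFullyInvariant_squarefree (k : ℕ) :
    IsFullyInvariant fun a b =>
      a = b ∨ (k ≤ a.degree ∨ ∃ i, 2 ≤ a i) ∧ (k ≤ b.degree ∨ ∃ i, 2 ≤ b i) := by
  refine isFullyInvariant_ideal (I := fun a => k ≤ a.degree ∨ ∃ i, 2 ≤ a i) ?_ ?_
  · rintro a c (h | ⟨i, hi⟩)
    · left
      rw [map_add]
      exact h.trans (Nat.le_add_right _ _)
    · exact .inr ⟨i, hi.trans (Nat.le_add_right _ _)⟩
  · rintro a σ hσ (h | ⟨i, hi⟩)
    · exact .inl (h.trans (degree_le_degree_linearCombination hσ))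
    · obtain ⟨j, hj⟩ := Finsupp.ne_iff.1 (hσ i)
      refine .inr ⟨j, le_trans ?_ (mul_le_linearCombination_apply σ a i j)⟩
      exact hi.trans (Nat.le_mul_of_pos_right _ (Nat.pos_of_ne_zero hj))

/-- The variety in which all words of length at least `k` and all words divisible by a square
are zero. -/
noncomputable def sqfVariety (k : ℕ) : ComVariety := (isFullyInvariant_squarefree k).toVariety

theorem isFullyInvariant_support :
    IsFullyInvariant fun a b : ℕ →₀ ℕ => a.support = b.support where
  refl _ := rfl
  symm h := h.symm
  trans h h' := h.trans h'
  add_right {a b} h c := by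
    ext j
    have := Finset.ext_iff.1 h j
    simp only [Finsupp.mem_support_iff, not_iff_not, Finsupp.add_apply,
      ne_eq, Nat.add_eq_zero_iff] at this ⊢
    tauto
  subst {a b} h σ _ := by
    ext j
    rw [mem_support_linearCombination, mem_support_linearCombination, h]

/-- The variety of semilattices, given by all regular identities. -/
noncomputable def slVariety : ComVariety := isFullyInvariant_support.toVariety

theorem isFullyInvariant_modEq (n : ℕ) :
    IsFullyInvariant fun a b : ℕ →₀ ℕ => ∀ i, a i ≡ b i [MOD n] where
  refl _ _ := rfl
  symm h i := (h i).symm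
  trans h h' i := (h i).trans (h' i)
  add_right h c i := (h i).add_right _
  subst {a b} h σ _ j := by
    rw [linearCombination_nat_apply, linearCombination_nat_apply,
      Finsupp.sum_of_support_subset a (s := a.support ∪ b.support) Finset.subset_union_left _
        (by simp),
      Finsupp.sum_of_support_subset b (s := a.support ∪ b.support) Finset.subset_union_right _
        (by simp), ← ZMod.natCast_eq_natCast_iff]
    push_cast
    refine Finset.sum_congr rfl fun i _ => ?_
    rw [(ZMod.natCast_eq_natCast_iff _ _ _).2 (h i)]

/-- The variety of Abelian groups of exponent dividing `n`, given by all identities whose sides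
are congruent modulo `n`. -/
noncomputable def modVariety (n : ℕ) : ComVariety := (isFullyInvariant_modEq n).toVariety

theorem isFullyInvariant_swap (k : ℕ) :
    IsFullyInvariant fun a b : ℕ →₀ ℕ => a = b ∨ (k + 1 ≤ a.degree ∧ k + 1 ≤ b.degree) ∨
      (a.degree = k ∧ b.degree = k ∧ a.support = b.support) where
  refl _ := .inl rfl
  symm := by
    rintro a b (rfl | h | h)
    · exact .inl rfl
    · exact .inr (.inl ⟨h.2, h.1⟩)
    · exact .inr (.inr ⟨h.2.1, h.1, h.2.2.symm⟩)
  trans := by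
    rintro a b c (rfl | h | h) (rfl | h' | h')
    · exact .inl rfl
    · exact .inr (.inl h')
    · exact .inr (.inr h')
    · exact .inr (.inl h)
    · exact .inr (.inl ⟨h.1, h'.2⟩)
    · omega
    · exact .inr (.inr h)
    · omega
    · exact .inr (.inr ⟨h.1, h'.2.1, h.2.2.trans h'.2.2⟩)
  add_right := by
    rintro a b (rfl | h | h) c
    · exact .inl rfl
    · right; left
      simp only [map_add]
      omega
    · rcases eq_or_ne c 0 with rfl | hc
      · simp only [add_zero]
        exact .inr (.inr h)
      · have := one_le_degree hc
        right; left
        simp only [map_add]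
        omega
  subst := by
    rintro a b (rfl | h | ⟨ha, hb, hs⟩) σ hσ
    · exact .inl rfl
    · exact .inr (.inl ⟨h.1.trans (degree_le_degree_linearCombination hσ),
        h.2.trans (degree_le_degree_linearCombination hσ)⟩)
    · right
      by_cases hd : ∀ i ∈ a.support, (σ i).degree = 1
      · right
        have key : ∀ c : ℕ →₀ ℕ, c.support = a.support →
            (linearCombination ℕ σ c).degree = c.degree := by
          intro c hc
          rw [degree_linearCombination, Finsupp.degree_apply, Finsupp.sum, hc]
          exact Finset.sum_congr rfl fun i hi => by rw [hd i hi, mul_one]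
        refine ⟨(key a rfl).trans ha, (key b hs.symm).trans hb, ?_⟩
        ext j
        rw [mem_support_linearCombination, mem_support_linearCombination, hs]
      · left
        push Not at hd
        obtain ⟨i, hi, hd⟩ := hd
        have key : ∀ c : ℕ →₀ ℕ, c.support = a.support →
            c.degree + 1 ≤ (linearCombination ℕ σ c).degree := by
          intro c hc
          rw [degree_linearCombination, Finsupp.degree_apply, Finsupp.sum]
          refine Nat.succ_le_of_lt (Finset.sum_lt_sum (fun j _ => ?_) ⟨i, hc ▸ hi, ?_⟩)
          · exact Nat.le_mul_of_pos_right _ (one_le_degree (hσ j))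
          · have h1 : 0 < c i := Nat.pos_of_ne_zero (Finsupp.mem_support_iff.1 (hc ▸ hi))
            have h2 := one_le_degree (hσ i)
            exact lt_mul_of_one_lt_right h1 (by omega)
        exact ⟨ha ▸ key a rfl, hb ▸ key b hs.symm⟩

/-- The variety in which all words of length at least `k + 1` are zero and any two words of
length `k` with the same letters coincide. -/
noncomputable def swapVariety (k : ℕ) : ComVariety := (isFullyInvariant_swap k).toVariety

/-! ### Periods of identities -/

namespace ComVariety

variable {V W : ComVariety} {a b c e : ℕ →₀ ℕ}

theorem Rel.smul {s t : ℕ} (h : V.Rel (single 0 s) (single 0 t)) (hc : c ≠ 0) :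
    V.Rel (s • c) (t • c) := by
  simpa [Finsupp.linearCombination_single] using h.subst (σ := fun _ => c) fun _ => hc

theorem rel_period {s d : ℕ} (h : V.Rel (s • c) ((s + d) • c)) (k q : ℕ) :
    V.Rel ((s + k) • c) ((s + k + q * d) • c) := by
  have hk := h.add_right (k • c)
  rw [← add_smul, ← add_smul] at hk
  induction q with
  | zero => simpa using Rel.refl hk.ne_zero_left
  | succ q ih =>
    have := hk.add_right ((q * d) • c)
    rw [← add_smul, ← add_smul] at this
    refine ih.trans ?_
    convert this using 2
    ring

/-- The powers of `c` in `V` become periodic with period `d`. -/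
def IsPeriod (V : ComVariety) (d : ℕ) : Prop :=
  1 ≤ d ∧ ∃ s, 1 ≤ s ∧ ∀ c, c ≠ 0 → V.Rel (s • c) ((s + d) • c)

theorem isPeriod_of_lt {s t : ℕ} (hst : s < t) (h : V.Rel (single 0 s) (single 0 t)) :
    V.IsPeriod (t - s) := by
  refine ⟨by omega, s, ?_, fun c hc => ?_⟩
  · refine Nat.one_le_iff_ne_zero.2 ?_
    rintro rfl
    exact h.ne_zero_left (by simp)
  · have := h.smul hc
    rwa [show s + (t - s) = t by omega]

theorem IsPeriod.mod {d e : ℕ} (hd : V.IsPeriod d) (he : V.IsPeriod e) (h : e % d ≠ 0) :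
    V.IsPeriod (e % d) := by
  obtain ⟨hd1, s, hs, hd⟩ := hd
  obtain ⟨he1, t, ht, he⟩ := he
  refine ⟨by omega, s + t, by omega, fun c hc => ?_⟩
  have h1 := rel_period (hd c hc) (t + e % d) (e / d)
  have h2 := rel_period (he c hc) s 1
  have h3 : s + (t + e % d) + e / d * d = t + s + 1 * e := by
    have := Nat.mod_add_div e d
    rw [mul_comm] at this
    omega
  rw [h3] at h1
  convert h2.trans h1.symm using 2 <;> ring

theorem Rel.twoSubst (h : V.Rel a b) (i : ℕ) (hc : c ≠ 0) (he : e ≠ 0) :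
    V.Rel (a i • c + (a.erase i).degree • e) (b i • c + (b.erase i).degree • e) := by
  have := h.subst (twoSubst_ne_zero (i := i) hc he)
  rwa [linearCombination_twoSubst, linearCombination_twoSubst] at this

theorem Rel.single_twoSubst (h : V.Rel a b) (i : ℕ) {p q : ℕ} (hp : p ≠ 0) (hq : q ≠ 0) :
    V.Rel (single 0 (a i * p + (a.erase i).degree * q))
      (single 0 (b i * p + (b.erase i).degree * q)) := by
  have := h.twoSubst i (c := single 0 p) (e := single 0 q) (by simpa) (by simpa)
  simp only [Finsupp.smul_single, smul_eq_mul, ← Finsupp.single_add] at this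
  exact this

theorem exists_isPeriod_of_ne {s t : ℕ} (hst : s ≠ t) (h : V.Rel (single 0 s) (single 0 t)) :
    ∃ d, V.IsPeriod d ∧ (d = t - s ∧ s < t ∨ d = s - t ∧ t < s) := by
  rcases lt_or_gt_of_ne hst with hst | hst
  · exact ⟨_, isPeriod_of_lt hst h, .inl ⟨rfl, hst⟩⟩
  · exact ⟨_, isPeriod_of_lt hst h.symm, .inr ⟨rfl, hst⟩⟩

/-- A variety satisfying a nontrivial identity has a least period `d` and contains all Abelian
groups of exponent `d`. -/
theorem exists_isPeriod (h : V.Rel a b) (hab : a ≠ b) :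
    ∃ d, V.IsPeriod d ∧ modVariety d ≤ V := by
  classical
  have hex : ∃ d, V.IsPeriod d := by
    obtain ⟨i, hi⟩ := Finsupp.ne_iff.1 hab
    by_cases h1 : a i * 1 + (a.erase i).degree * 1 = b i * 1 + (b.erase i).degree * 1
    · obtain ⟨d, hd, -⟩ := exists_isPeriod_of_ne (by omega)
        (h.single_twoSubst i two_ne_zero one_ne_zero)
      exact ⟨d, hd⟩
    · obtain ⟨d, hd, -⟩ := exists_isPeriod_of_ne h1
        (h.single_twoSubst i one_ne_zero one_ne_zero)
      exact ⟨d, hd⟩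
  have hd := Nat.find_spec hex
  have hmin : ∀ e, V.IsPeriod e → Nat.find hex ∣ e := fun e he => by
    by_contra hne
    have h0 : e % Nat.find hex ≠ 0 := fun h0 => hne (Nat.dvd_of_mod_eq_zero h0)
    exact Nat.find_min hex (Nat.mod_lt _ hd.1) (hd.mod he h0)
  generalize Nat.find hex = d at hd hmin
  refine ⟨d, hd, le_iff_rel.2 fun a b hab => ?_⟩
  refine (isFullyInvariant_modEq d).rel_toVariety.2 ⟨hab.ne_zero_left, hab.ne_zero_right, ?_⟩
  intro i
  have hd0 : d ≠ 0 := Nat.one_le_iff_ne_zero.1 hd.1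
  have hr := hab.single_twoSubst i one_ne_zero hd0
  have key : a i * 1 + (a.erase i).degree * d ≡ b i * 1 + (b.erase i).degree * d [MOD d] := by
    by_cases hst : a i * 1 + (a.erase i).degree * d = b i * 1 + (b.erase i).degree * d
    · rw [hst]
    · obtain ⟨f, hf, ⟨rfl, hlt⟩ | ⟨rfl, hlt⟩⟩ := exists_isPeriod_of_ne hst hr
      · exact (Nat.modEq_iff_dvd' hlt.le).2 (hmin _ hf)
      · exact ((Nat.modEq_iff_dvd' hlt.le).2 (hmin _ hf)).symm
  simpa [Nat.ModEq] using key

/-! ### Excluding atoms -/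

theorem rel_nilpVariety {k : ℕ} : (nilpVariety k).Rel a b ↔
    a ≠ 0 ∧ b ≠ 0 ∧ (a = b ∨ k ≤ a.degree ∧ k ≤ b.degree) :=
  (isFullyInvariant_degree k).rel_toVariety

theorem rel_sqfVariety {k : ℕ} : (sqfVariety k).Rel a b ↔ a ≠ 0 ∧ b ≠ 0 ∧
    (a = b ∨ (k ≤ a.degree ∨ ∃ i, 2 ≤ a i) ∧ (k ≤ b.degree ∨ ∃ i, 2 ≤ b i)) :=
  (isFullyInvariant_squarefree k).rel_toVariety

theorem rel_slVariety : slVariety.Rel a b ↔ a ≠ 0 ∧ b ≠ 0 ∧ a.support = b.support :=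
  isFullyInvariant_support.rel_toVariety

theorem rel_modVariety {n : ℕ} :
    (modVariety n).Rel a b ↔ a ≠ 0 ∧ b ≠ 0 ∧ ∀ i, a i ≡ b i [MOD n] :=
  (isFullyInvariant_modEq n).rel_toVariety

theorem rel_swapVariety {k : ℕ} : (swapVariety k).Rel a b ↔ a ≠ 0 ∧ b ≠ 0 ∧
    (a = b ∨ (k + 1 ≤ a.degree ∧ k + 1 ≤ b.degree) ∨
      (a.degree = k ∧ b.degree = k ∧ a.support = b.support)) :=
  (isFullyInvariant_swap k).rel_toVariety

/-- The variety of null semigroups. -/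
noncomputable abbrev zmVariety : ComVariety := nilpVariety 2

theorem exists_rel_of_not_zm_le (h : ¬ zmVariety ≤ V) :
    (∃ a b, V.Rel a b ∧ a ≠ b) ∧ ∃ m, 1 ≤ m ∧ ∀ c, c ≠ 0 → V.Rel c ((1 + m) • c) := by
  obtain ⟨a, b, hab, h⟩ := not_le_iff_rel.1 h
  wlog ha : a.degree < 2 generalizing a b
  · refine this b a hab.symm (fun h' => h h'.symm) ?_
    rw [rel_nilpVariety] at h
    by_contra hb
    exact h ⟨hab.ne_zero_left, hab.ne_zero_right, .inr ⟨not_lt.1 ha, not_lt.1 hb⟩⟩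
  have hne : a ≠ b := by
    rintro rfl
    exact h (Rel.refl hab.ne_zero_left)
  refine ⟨⟨a, b, hab, hne⟩, ?_⟩
  obtain ⟨i, hi⟩ := Finsupp.ne_iff.1 hab.ne_zero_left
  have hi : a i ≠ 0 := hi
  have hsum := apply_add_degree_erase (a := a) i
  have hai : a i = 1 := by omega
  have hae : (a.erase i).degree = 0 := by omega
  refine ⟨b i + (b.erase i).degree * 2 - 1, ?_, fun c hc => ?_⟩
  · by_contra hlt
    have hbe : (b.erase i).degree = 0 := by omega
    have hb1 := one_le_degree hab.ne_zero_right
    have hbi : b i = 1 := by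
      have := apply_add_degree_erase (a := b) i
      omega
    refine hne ?_
    rw [← Finsupp.single_add_erase i a, ← Finsupp.single_add_erase i b, hai, hbi,
      (Finsupp.degree_eq_zero_iff _).1 hae, (Finsupp.degree_eq_zero_iff _).1 hbe]
  · have := hab.twoSubst i hc (e := 2 • c) (smul_ne_zero two_ne_zero hc)
    rw [hai, hae, one_smul, zero_smul, add_zero, smul_smul, ← add_smul] at this
    convert this using 2
    have : b i + (b.erase i).degree * 2 ≠ 0 := by
      intro h0
      rw [h0, zero_smul] at this
      exact this.ne_zero_right rfl
    omega

theorem exists_rel_of_not_sl_le (h : ¬ slVariety ≤ V) :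
    (∃ a b, V.Rel a b ∧ a ≠ b) ∧ ∃ p q l : ℕ, p ≠ 0 ∧ l ≠ 0 ∧
      ∀ c e : ℕ →₀ ℕ, c ≠ 0 → e ≠ 0 → V.Rel (p • c + q • e) (l • e) := by
  obtain ⟨a, b, hab, h⟩ := not_le_iff_rel.1 h
  have hs : a.support ≠ b.support := fun h' =>
    h (rel_slVariety.2 ⟨hab.ne_zero_left, hab.ne_zero_right, h'⟩)
  refine ⟨⟨a, b, hab, fun h' => hs (by rw [h'])⟩, ?_⟩
  clear h
  have hi : ∃ i, ¬ (i ∈ a.support ↔ i ∈ b.support) := by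
    by_contra! h
    exact hs (Finset.ext h)
  obtain ⟨i, hi⟩ := hi
  wlog hia : i ∈ a.support generalizing a b
  · exact this b a hab.symm hs.symm (by tauto) (by tauto)
  have hib : b i = 0 := by
    by_contra h0
    exact hi (iff_of_true hia (Finsupp.mem_support_iff.2 h0))
  refine ⟨a i, (a.erase i).degree, b.degree, Finsupp.mem_support_iff.1 hia,
    Nat.one_le_iff_ne_zero.1 (one_le_degree hab.ne_zero_right), fun c e hc he => ?_⟩
  have := hab.twoSubst i hc he
  have h2 := apply_add_degree_erase (a := b) i
  rwa [hib, zero_smul, zero_add, show (b.erase i).degree = b.degree by omega] at this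

theorem rel_one_add_of_isPeriod {d m : ℕ} (hd : V.IsPeriod d) (hm : 1 ≤ m)
    (h : ∀ c, c ≠ 0 → V.Rel c ((1 + m) • c)) (hc : c ≠ 0) : V.Rel c ((1 + d) • c) := by
  obtain ⟨-, s, hs, hd⟩ := hd
  have h1 : V.Rel c ((1 + s * m) • c) := by
    have := rel_period (s := 1) (d := m) (by simpa using h c hc) 0 s
    simpa using this
  have hsm : s ≤ s * m := Nat.le_mul_of_pos_right _ hm
  have h2 := rel_period (hd c hc) (1 + s * m - s) 1
  rw [show s + (1 + s * m - s) = 1 + s * m by omega, one_mul] at h2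
  have h3 := h1.add_right (d • c)
  rw [← add_smul] at h3
  rw [add_smul, one_smul]
  exact h1.trans (h2.trans h3.symm)

/-- A variety containing neither the semilattices nor the null semigroups is a group variety. -/
theorem exists_eq_modVariety (hsl : ¬ slVariety ≤ V) (hzm : ¬ zmVariety ≤ V) :
    ∃ n, 1 ≤ n ∧ V = modVariety n := by
  obtain ⟨⟨a, b, hab, hne⟩, m, hm, hx⟩ := exists_rel_of_not_zm_le hzm
  obtain ⟨-, p, q, l, hp, hl, hpq⟩ := exists_rel_of_not_sl_le hsl
  obtain ⟨d, hd, hle⟩ := exists_isPeriod hab hne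
  have hd0 : d ≠ 0 := Nat.one_le_iff_ne_zero.1 hd.1
  have hxd : ∀ c, c ≠ 0 → V.Rel (1 • c) ((1 + d) • c) := fun c hc => by
    rw [one_smul]
    exact rel_one_add_of_isPeriod hd hm hx hc
  have hunit : ∀ c e : ℕ →₀ ℕ, c ≠ 0 → e ≠ 0 → V.Rel (d • c + e) e := by
    intro c e hc he
    have h1 := hpq (d • c) e (smul_ne_zero hd0 hc) he
    have h2 := rel_period (hxd c hc) (d - 1) (p - 1)
    have hpd : d + (p - 1) * d = p * d := by
      obtain ⟨r, rfl⟩ := Nat.exists_eq_succ_of_ne_zero hp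
      rw [Nat.succ_sub_one, Nat.succ_mul, add_comm]
    rw [show 1 + (d - 1) = d by omega, hpd, mul_smul] at h2
    have h3 : V.Rel (d • c + q • e) (l • e) := (h2.add_right _).trans h1
    have h4 := rel_period (hxd c hc) (d - 1) 1
    rw [show 1 + (d - 1) = d by omega, one_mul, add_smul] at h4
    have h5 : V.Rel (d • c + l • e) (l • e) := by
      have h6 := h3.add_left (d • c)
      rw [← add_assoc] at h6
      exact h6.symm.trans ((h4.symm.add_right _).trans h3)
    have hld : l ≤ l * d := Nat.le_mul_of_pos_right _ hd.1
    have h6 := h5.add_right ((1 + l * d - l) • e)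
    rw [add_assoc, ← add_smul, show l + (1 + l * d - l) = 1 + l * d by omega] at h6
    have h7 := rel_period (hxd e he) 0 l
    rw [add_zero, one_smul] at h7
    exact (h7.add_left _).trans (h6.trans h7.symm)
  refine ⟨d, hd.1, le_antisymm (le_iff_rel.2 fun a b h => ?_) hle⟩
  obtain ⟨ha, hb, h⟩ := rel_modVariety.1 h
  have key : ∀ a : ℕ →₀ ℕ, a ≠ 0 → ∀ b, (∀ i, a i ≡ b i [MOD d]) → a ≤ b → V.Rel a b := by
    intro a ha b hab hle
    let c : ℕ →₀ ℕ := (b - a).mapRange (· / d) (Nat.zero_div d)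
    have hc : b = d • c + a := by
      ext i
      have h1 : d ∣ b i - a i := (Nat.modEq_iff_dvd' (hle i)).1 (hab i)
      have h2 : d * ((b i - a i) / d) = b i - a i := Nat.mul_div_cancel' h1
      have h3 := hle i
      simp only [c, Finsupp.add_apply, Finsupp.smul_apply, Finsupp.mapRange_apply,
        Finsupp.tsub_apply, smul_eq_mul]
      omega
    rcases eq_or_ne c 0 with h0 | h0
    · rw [h0, smul_zero, zero_add] at hc
      rw [hc]
      exact Rel.refl ha
    · rw [hc]
      exact (hunit c a h0 ha).symm
  refine (key a ha (a ⊔ b) (fun i => ?_) le_sup_left).trans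
    (key b hb (a ⊔ b) (fun i => ?_) le_sup_right).symm
  · rw [Finsupp.sup_apply]
    rcases le_total (a i) (b i) with h' | h'
    · rw [sup_eq_right.2 h']; exact h i
    · rw [sup_eq_left.2 h']
  · rw [Finsupp.sup_apply]
    rcases le_total (a i) (b i) with h' | h'
    · rw [sup_eq_right.2 h']
    · rw [sup_eq_left.2 h']; exact (h i).symm

/-- The word with exponent vector `a` is zero in `V`. -/
def IsZero (V : ComVariety) (a : ℕ →₀ ℕ) : Prop := ∀ c, V.Rel a (a + c)

/-- Some power of a letter is zero in `V`. -/
def IsNil (V : ComVariety) : Prop := ∃ s, V.IsZero (single 0 s)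

theorem modVariety_le_of_dvd {m n : ℕ} (h : m ∣ n) : modVariety m ≤ modVariety n :=
  le_iff_rel.2 fun a b hab => by
    rw [rel_modVariety] at hab ⊢
    exact ⟨hab.1, hab.2.1, fun i => (hab.2.2 i).of_dvd h⟩

theorem isPeriod_one_of_no_prime (h : V.Rel a b) (hab : a ≠ b)
    (hp : ∀ p, p.Prime → ¬ modVariety p ≤ V) : V.IsPeriod 1 := by
  obtain ⟨d, hd, hle⟩ := exists_isPeriod h hab
  by_cases h1 : d = 1
  · rwa [h1] at hd
  · exact absurd ((modVariety_le_of_dvd d.minFac_dvd).trans hle) (hp _ (Nat.minFac_prime h1))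

/-- A variety containing neither the semilattices nor groups of prime order is nil. -/
theorem isNil_of_not_le (hsl : ¬ slVariety ≤ V) (hp : ∀ p, p.Prime → ¬ modVariety p ≤ V) :
    V.IsNil := by
  obtain ⟨⟨a, b, hab, hne⟩, p, q, l, hp0, hl, hpq⟩ := exists_rel_of_not_sl_le hsl
  obtain ⟨-, s, hs, hper⟩ := isPeriod_one_of_no_prime hab hne hp
  refine ⟨s, fun c => ?_⟩
  obtain ⟨e, hes, he⟩ : ∃ e : ℕ →₀ ℕ, single 0 s = s • e ∧ e ≠ 0 := ⟨single 0 1, by simp, by simp⟩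
  rw [hes]
  rcases eq_or_ne c 0 with rfl | hc
  · rw [add_zero]
    exact Rel.refl (smul_ne_zero (by omega) he)
  have h1 : ∀ c : ℕ →₀ ℕ, c ≠ 0 → V.Rel (p • c + s • e) (s • e) := by
    intro c hc
    have h := (hpq c e hc he).add_right (s • e)
    rw [add_assoc, ← add_smul, ← add_smul] at h
    have h2 := rel_period (hper e he) 0 q
    have h3 := rel_period (hper e he) 0 l
    rw [add_zero, mul_one, add_comm] at h2 h3
    exact (h2.add_left _).trans (h.trans h3.symm)
  have h2 := h1 (s • c) (smul_ne_zero (by omega) hc)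
  have h3 := rel_period (hper c hc) (p * s - s) 1
  have hps : s ≤ p * s := Nat.le_mul_of_pos_left _ (Nat.pos_of_ne_zero hp0)
  rw [show s + (p * s - s) = p * s by omega, mul_one, mul_smul, add_smul, one_smul, mul_smul] at h3
  have h4 := h2.add_right c
  refine h2.symm.trans (.trans ?_ h4)
  rw [add_right_comm]
  exact h3.add_right _

/-- A variety containing neither the null semigroups nor groups of prime order consists of
semilattices. -/
theorem le_slVariety_of_not_le (hzm : ¬ zmVariety ≤ V)
    (hp : ∀ p, p.Prime → ¬ modVariety p ≤ V) : V ≤ slVariety := by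
  obtain ⟨⟨a, b, hab, hne⟩, m, hm, hx⟩ := exists_rel_of_not_zm_le hzm
  have hper := isPeriod_one_of_no_prime hab hne hp
  have h1 : ∀ c, c ≠ 0 → V.Rel (1 • c) ((1 + 1) • c) := fun c hc => by
    rw [one_smul]
    exact rel_one_add_of_isPeriod hper hm hx hc
  have key : ∀ c a : ℕ →₀ ℕ, a ≠ 0 → c.support ⊆ a.support → V.Rel a (a + c) := by
    intro c
    induction c using Finsupp.induction with
    | zero => exact fun a ha _ => by simpa using Rel.refl ha
    | single_add i k f hi hk ih =>
      intro a ha hs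
      rw [Finsupp.support_single_add hi hk, Finset.cons_subset] at hs
      refine (ih a ha hs.2).trans ?_
      have hai : a i ≠ 0 := Finsupp.mem_support_iff.1 hs.1
      have h2 := rel_period (h1 (single i 1) (by simp)) (a i - 1) k
      rw [show 1 + (a i - 1) = a i by omega, mul_one] at h2
      simp only [Finsupp.smul_single, smul_eq_mul, mul_one, Finsupp.single_add] at h2
      have h3 := h2.add_right (a.erase i + f)
      have h4 := Finsupp.single_add_erase i a
      convert h3 using 1
      · rw [← add_assoc, h4]
      · conv_lhs => rw [← h4]
        abel
  refine le_iff_rel.2 fun a b h => ?_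
  obtain ⟨ha, hb, h⟩ := rel_slVariety.1 h
  have h2 := key a b hb h.le
  rw [add_comm] at h2
  exact (key b a ha h.ge).trans h2.symm

end ComVariety

/-! ### Atoms of the lattice -/

/-- The exponent vector of the word `x₀x₁⋯x_{k-1}`. -/
noncomputable def linearVec (k : ℕ) : ℕ →₀ ℕ := ∑ i ∈ Finset.range k, single i 1

theorem degree_linearVec (k : ℕ) : (linearVec k).degree = k := by
  simp [linearVec, map_sum]

theorem linearVec_apply (k i : ℕ) : linearVec k i = if i < k then 1 else 0 := by
  simp [linearVec, Finsupp.finsetSum_apply, Finsupp.single_apply]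

theorem linearVec_apply_le (k i : ℕ) : linearVec k i ≤ 1 := by
  rw [linearVec_apply]
  split_ifs <;> omega

theorem linearVec_ne_zero {k : ℕ} (hk : k ≠ 0) : linearVec k ≠ 0 := by
  intro h
  have := degree_linearVec k
  rw [h, map_zero] at this
  exact hk this.symm

namespace ComVariety

variable {V W : ComVariety} {a b c e : ℕ →₀ ℕ} {m n p : ℕ}

theorem rel_single_mod_succ : (modVariety m).Rel (single 0 (m + 1)) (single 0 1) :=
  rel_modVariety.2 ⟨by simp, by simp, fun i => by
    rcases eq_or_ne i 0 with rfl | hi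
    · simp [Nat.ModEq]
    · simp [hi, Nat.ModEq]⟩

theorem dvd_of_rel_single {s t : ℕ} (h : (modVariety n).Rel (single 0 (s + t)) (single 0 t)) :
    n ∣ s := by
  have := (rel_modVariety.1 h).2.2 0
  simp only [Finsupp.single_eq_same] at this
  have := (Nat.modEq_iff_dvd' (Nat.le_add_left t s)).1 this.symm
  rwa [Nat.add_sub_cancel] at this

theorem modVariety_le_modVariety : modVariety n ≤ modVariety m ↔ n ∣ m :=
  ⟨fun h => dvd_of_rel_single (le_iff_rel.1 h _ _ rel_single_mod_succ), modVariety_le_of_dvd⟩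

theorem modVariety_inj : modVariety n = modVariety m ↔ n = m :=
  ⟨fun h => Nat.dvd_antisymm (modVariety_le_modVariety.1 h.le) (modVariety_le_modVariety.1 h.ge),
    congrArg _⟩

theorem modVariety_one : modVariety 1 = ⊥ :=
  eq_bot_of_rel fun _ _ ha hb => rel_modVariety.2 ⟨ha, hb, fun _ => Nat.modEq_one⟩

theorem not_sl_le_modVariety (hn : 1 ≤ n) : ¬ slVariety ≤ modVariety n := by
  intro h
  have h1 : (modVariety n).Rel (single 0 n + single 1 1) (single 1 1) :=
    rel_modVariety.2 ⟨by simp, by simp, fun i => by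
      rcases eq_or_ne i 0 with rfl | hi
      · simp [Nat.ModEq]
      · simp [hi, Nat.ModEq]⟩
  have h2 := Finset.ext_iff.1 (rel_slVariety.1 (le_iff_rel.1 h _ _ h1)).2.2 0
  simp at h2
  omega

theorem not_zm_le_modVariety (hn : 1 ≤ n) : ¬ zmVariety ≤ modVariety n := by
  intro h
  have h2 := (rel_nilpVariety.1 (le_iff_rel.1 h _ _ rel_single_mod_succ)).2.2
  rw [(Finsupp.single_injective 0).eq_iff, Finsupp.degree_single, Finsupp.degree_single] at h2
  omega

theorem rel_sl_two_one : slVariety.Rel (single 0 2) (single 0 1) :=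
  rel_slVariety.2 ⟨by simp, by simp, by
    rw [Finsupp.support_single 0 two_ne_zero, Finsupp.support_single 0 one_ne_zero]⟩

theorem not_zm_le_sl : ¬ zmVariety ≤ slVariety := by
  intro h
  have h2 := (rel_nilpVariety.1 (le_iff_rel.1 h _ _ rel_sl_two_one)).2.2
  rw [(Finsupp.single_injective 0).eq_iff, Finsupp.degree_single, Finsupp.degree_single] at h2
  omega

theorem isNil_nilpVariety (k : ℕ) : (nilpVariety k).IsNil :=
  ⟨k + 1, fun c => rel_nilpVariety.2 ⟨by simp, by simp, .inr ⟨by simp, by simp; omega⟩⟩⟩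

theorem isNil_sqfVariety (k : ℕ) : (sqfVariety k).IsNil :=
  ⟨2, fun c => rel_sqfVariety.2 ⟨by simp, by simp, .inr ⟨.inr ⟨0, by simp⟩, .inr ⟨0, by simp⟩⟩⟩⟩

theorem IsNil.not_sl_le (h : V.IsNil) : ¬ slVariety ≤ V := by
  obtain ⟨s, hs⟩ := h
  intro h
  have h2 := Finset.ext_iff.1 (rel_slVariety.1 (le_iff_rel.1 h _ _ (hs (single 1 1)))).2.2 1
  simp at h2

theorem IsNil.eq_one_of_modVariety_le (h : V.IsNil) (hm : modVariety m ≤ V) : m = 1 := by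
  obtain ⟨s, hs⟩ := h
  have h2 := (le_iff_rel.1 hm _ _ (hs (single 0 1))).symm
  rw [← Finsupp.single_add, add_comm] at h2
  exact Nat.dvd_one.1 (dvd_of_rel_single h2)

theorem sl_ne_zm : slVariety ≠ zmVariety := fun h => not_zm_le_sl h.ge

theorem isAtom_slVariety : IsAtom slVariety := by
  refine ⟨fun h => ?_, fun W hW => ?_⟩
  · exact (isNil_nilpVariety 2).not_sl_le (h ▸ bot_le)
  · obtain ⟨m, -, rfl⟩ := exists_eq_modVariety hW.not_ge
      fun h => not_zm_le_sl (h.trans hW.le)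
    have h1 := dvd_of_rel_single (s := 1) (t := 1) (le_iff_rel.1 hW.le _ _ rel_sl_two_one)
    rw [Nat.dvd_one.1 h1, modVariety_one]

theorem isAtom_zmVariety : IsAtom zmVariety := by
  refine ⟨fun h => ?_, fun W hW => ?_⟩
  · exact not_zm_le_sl (h ▸ bot_le)
  · obtain ⟨m, -, rfl⟩ := exists_eq_modVariety
      (fun h => (isNil_nilpVariety 2).not_sl_le (h.trans hW.le)) hW.not_ge
    rw [(isNil_nilpVariety 2).eq_one_of_modVariety_le hW.le, modVariety_one]

theorem isAtom_modVariety (hp : p.Prime) : IsAtom (modVariety p) := by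
  refine ⟨fun h => ?_, fun W hW => ?_⟩
  · rw [← modVariety_one, modVariety_inj] at h
    exact hp.one_lt.ne' h
  · obtain ⟨m, -, rfl⟩ := exists_eq_modVariety
      (fun h => not_sl_le_modVariety hp.one_le (h.trans hW.le))
      (fun h => not_zm_le_modVariety hp.one_le (h.trans hW.le))
    rcases (Nat.dvd_prime hp).1 (modVariety_le_modVariety.1 hW.le) with rfl | rfl
    · exact modVariety_one
    · exact absurd hW (lt_irrefl _)

theorem eq_of_isAtom (h : IsAtom V) :
    V = slVariety ∨ V = zmVariety ∨ ∃ p, p.Prime ∧ V = modVariety p := by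
  by_cases hsl : slVariety ≤ V
  · exact .inl ((h.le_iff_eq isAtom_slVariety.1).1 hsl).symm
  by_cases hzm : zmVariety ≤ V
  · exact .inr (.inl ((h.le_iff_eq isAtom_zmVariety.1).1 hzm).symm)
  obtain ⟨n, -, rfl⟩ := exists_eq_modVariety hsl hzm
  have hn : n ≠ 1 := fun h1 => h.1 (h1 ▸ modVariety_one)
  have hp := Nat.minFac_prime hn
  exact .inr (.inr ⟨_, hp,
    ((h.le_iff_eq (isAtom_modVariety hp).1).1 (modVariety_le_of_dvd n.minFac_dvd)).symm⟩)

theorem isNil_iff_soleAtom : V.IsNil ↔ SoleAtom zmVariety V := by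
  constructor
  · intro hV y hy hyV
    rcases eq_of_isAtom hy with rfl | rfl | ⟨p, hp, rfl⟩
    · exact absurd hyV hV.not_sl_le
    · rfl
    · exact absurd (hV.eq_one_of_modVariety_le hyV) hp.one_lt.ne'
  · intro h
    refine isNil_of_not_le (fun hsl => sl_ne_zm (h _ isAtom_slVariety hsl)) fun p hp hpV => ?_
    exact not_zm_le_modVariety hp.one_le (h _ (isAtom_modVariety hp) hpV).ge

theorem soleAtom_modVariety_iff (hp : p.Prime) :
    SoleAtom (modVariety p) V ↔ ∃ k, V = modVariety (p ^ k) := by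
  constructor
  · intro h
    obtain ⟨n, hn, rfl⟩ := exists_eq_modVariety
      (fun hsl => not_sl_le_modVariety hp.one_le (h _ isAtom_slVariety hsl).le)
      (fun hzm => not_zm_le_modVariety hp.one_le (h _ isAtom_zmVariety hzm).le)
    refine ⟨_, congrArg _ (Nat.eq_prime_pow_of_unique_prime_dvd (by omega) fun {q} hq hqn => ?_)⟩
    exact modVariety_inj.1 (h _ (isAtom_modVariety hq) (modVariety_le_of_dvd hqn))
  · rintro ⟨k, rfl⟩ y hy hyV
    rcases eq_of_isAtom hy with rfl | rfl | ⟨q, hq, rfl⟩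
    · exact absurd hyV (not_sl_le_modVariety (Nat.pow_pos hp.pos))
    · exact absurd hyV (not_zm_le_modVariety (Nat.pow_pos hp.pos))
    · rw [(Nat.prime_dvd_prime_iff_eq hq hp).1
        (hq.dvd_of_dvd_pow (modVariety_le_modVariety.1 hyV))]

theorem le_slVariety_of_soleAtom (h : SoleAtom slVariety V) : V ≤ slVariety :=
  le_slVariety_of_not_le (fun hzm => sl_ne_zm (h _ isAtom_zmVariety hzm).symm)
    fun _ hp hpV => not_sl_le_modVariety hp.one_le (h _ (isAtom_modVariety hp) hpV).ge

theorem not_nilp_three_le_sqf (k : ℕ) : ¬ nilpVariety 3 ≤ sqfVariety k := by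
  intro h
  have h1 : (sqfVariety k).Rel (single 0 2) (single 0 3) :=
    rel_sqfVariety.2 ⟨by simp, by simp, .inr ⟨.inr ⟨0, by simp⟩, .inr ⟨0, by simp⟩⟩⟩
  have h2 := (rel_nilpVariety.1 (le_iff_rel.1 h _ _ h1)).2.2
  rw [(Finsupp.single_injective 0).eq_iff, Finsupp.degree_single, Finsupp.degree_single] at h2
  omega

theorem not_isZero_sqfVariety (k : ℕ) : ¬ (sqfVariety (k + 1)).IsZero (linearVec k) := by
  intro h
  obtain ⟨-, -, h | ⟨h | ⟨i, hi⟩, -⟩⟩ := rel_sqfVariety.1 (h (single 0 1))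
  · simp at h
  · rw [degree_linearVec] at h
    omega
  · have := linearVec_apply_le k i
    omega

theorem isZero_nilpVariety {k : ℕ} (ha : a ≠ 0) (hk : k ≤ a.degree) : (nilpVariety k).IsZero a :=
  fun c => rel_nilpVariety.2 ⟨ha, by simp [ha], .inr ⟨hk, by rw [map_add]; omega⟩⟩

theorem not_sqf_le_nilp_three : ¬ sqfVariety 4 ≤ nilpVariety 3 := fun h =>
  not_isZero_sqfVariety 3 fun c => le_iff_rel.1 h _ _
    (isZero_nilpVariety (linearVec_ne_zero three_ne_zero) (degree_linearVec 3).ge c)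

theorem zmLike_iff : ZMLike V ↔ V = zmVariety := by
  constructor
  · rintro ⟨hV, v, w, hv, hw, hvw, hwv⟩
    rcases eq_of_isAtom hV with rfl | rfl | ⟨p, hp, rfl⟩
    · rcases isAtom_slVariety.le_iff.1 (le_slVariety_of_soleAtom hv) with rfl | rfl
      · exact absurd bot_le hvw
      · exact absurd (le_slVariety_of_soleAtom hw) hwv
    · rfl
    · obtain ⟨k, rfl⟩ := (soleAtom_modVariety_iff hp).1 hv
      obtain ⟨l, rfl⟩ := (soleAtom_modVariety_iff hp).1 hw
      rcases le_total k l with h | h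
      · exact absurd (modVariety_le_of_dvd (pow_dvd_pow p h)) hvw
      · exact absurd (modVariety_le_of_dvd (pow_dvd_pow p h)) hwv
  · rintro rfl
    exact ⟨isAtom_zmVariety, _, _, isNil_iff_soleAtom.1 (isNil_nilpVariety 3),
      isNil_iff_soleAtom.1 (isNil_sqfVariety 4), not_nilp_three_le_sqf 4, not_sqf_le_nilp_three⟩

theorem slLike_iff : SLLike V ↔ V = slVariety := by
  constructor
  · rintro ⟨hV, h⟩
    rcases eq_of_isAtom hV with rfl | rfl | ⟨p, hp, rfl⟩
    · rfl
    · have h1 := h _ (isNil_iff_soleAtom.1 (isNil_nilpVariety 3))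
      have h2 := isZero_nilpVariety (k := 2) (a := single 0 2) (by simp) (by simp) (single 0 1)
      have h3 := (rel_nilpVariety.1 (le_iff_rel.1 h1 _ _ h2)).2.2
      simp at h3
    · have h1 := modVariety_le_modVariety.1 (h _ ((soleAtom_modVariety_iff hp).2 ⟨2, rfl⟩))
      have h2 := Nat.le_of_dvd hp.pos h1
      nlinarith [hp.one_lt]
  · rintro rfl
    exact ⟨isAtom_slVariety, fun _ => le_slVariety_of_soleAtom⟩

theorem nilLike_iff : NilLike V ↔ V.IsNil := by
  simp only [NilLike, zmLike_iff, isNil_iff_soleAtom, SoleAtom]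

theorem abGroupLike_iff : AbGroupLike V ↔ ∃ m, 1 ≤ m ∧ V = modVariety m := by
  simp only [AbGroupLike, zmLike_iff, slLike_iff]
  constructor
  · exact fun h => exists_eq_modVariety (fun hsl => (h _ isAtom_slVariety hsl).2 rfl)
      fun hzm => (h _ isAtom_zmVariety hzm).1 rfl
  · rintro ⟨m, hm, rfl⟩ y - hyV
    refine ⟨?_, ?_⟩ <;> rintro rfl
    · exact not_zm_le_modVariety hm hyV
    · exact not_sl_le_modVariety hm hyV

end ComVariety

/-! ### Nil varieties -/

theorem linearCombination_update (σ : ℕ → ℕ →₀ ℕ) (i : ℕ) (c a : ℕ →₀ ℕ) :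
    linearCombination ℕ (Function.update σ i c) a =
      a i • c + linearCombination ℕ σ (a.erase i) := by
  conv_lhs => rw [← Finsupp.single_add_erase i a]
  rw [map_add, Finsupp.linearCombination_single, Function.update_self]
  congr 1
  rw [Finsupp.linearCombination_apply, Finsupp.linearCombination_apply]
  refine Finsupp.sum_congr fun j hj => ?_
  simp only [Finsupp.support_erase, Finset.mem_erase] at hj
  rw [Function.update_of_ne hj.1]

theorem linearCombination_single_one (a : ℕ →₀ ℕ) :
    linearCombination ℕ (fun j => single j 1) a = a := by
  simp [Finsupp.linearCombination_apply]

theorem update_ne_zero {σ : ℕ → ℕ →₀ ℕ} (hσ : ∀ i, σ i ≠ 0) (i : ℕ) {c : ℕ →₀ ℕ}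
    (hc : c ≠ 0) (j : ℕ) : Function.update σ i c j ≠ 0 := by
  rcases eq_or_ne j i with rfl | h
  · rwa [Function.update_self]
  · rw [Function.update_of_ne h]
    exact hσ j

theorem erase_eq_self {a : ℕ →₀ ℕ} {i : ℕ} (h : a i = 0) : a.erase i = a :=
  Finsupp.erase_of_notMem_support (Finsupp.notMem_support_iff.2 h)

/-- Every vector of degree at least `k` is a multiple of an instance of `linearVec k`. -/
theorem exists_subst_linearVec (k : ℕ) (a : ℕ →₀ ℕ) (hk : k ≤ a.degree) :
    ∃ σ : ℕ → ℕ →₀ ℕ, (∀ i, σ i ≠ 0) ∧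
      ∃ c, a = linearCombination ℕ σ (linearVec k) + c := by
  induction k generalizing a with
  | zero => exact ⟨fun j => single j 1, by simp, a, by simp [linearVec]⟩
  | succ k ih =>
    obtain ⟨i, hi⟩ : ∃ i, a i ≠ 0 := by
      by_contra! h
      have : a = 0 := Finsupp.ext h
      simp [this] at hk
    have hai : a = single i 1 + (a - single i 1) :=
      (add_tsub_cancel_of_le (Finsupp.single_le_iff.2 (Nat.one_le_iff_ne_zero.2 hi))).symm
    have hdeg := congrArg Finsupp.degree hai
    rw [map_add, Finsupp.degree_single] at hdeg
    obtain ⟨σ, hσ, c, hc⟩ := ih (a - single i 1) (by omega)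
    refine ⟨Function.update σ k (single i 1), update_ne_zero hσ k (by simp), c, ?_⟩
    have h1 : (linearVec (k + 1)) k = 1 := by simp [linearVec_apply]
    have h2 : (linearVec (k + 1)).erase k = linearVec k := by
      ext j
      rcases eq_or_ne j k with rfl | hj
      · simp [linearVec_apply]
      · simp only [Finsupp.erase_ne hj, linearVec_apply]
        congr 1
        simp only [eq_iff_iff]
        omega
    rw [linearCombination_update, h1, h2, one_smul, add_assoc, ← hc, ← hai]

/-- Squarefree vectors can be renamed to `linearVec`. -/
theorem exists_subst_eq_linearVec {a : ℕ →₀ ℕ} (ha : ∀ i, a i ≤ 1) :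
    ∃ σ : ℕ → ℕ →₀ ℕ, (∀ i, σ i ≠ 0) ∧ linearCombination ℕ σ a = linearVec a.degree := by
  have h1 : ∀ i ∈ a.support, a i = 1 := fun i hi => by
    have := Finsupp.mem_support_iff.1 hi
    have := ha i
    omega
  have hcard : a.support.card = (Finset.range a.degree).card := by
    rw [Finset.card_range, Finsupp.degree_apply, Finset.card_eq_sum_ones]
    exact Finset.sum_congr rfl fun i hi => (h1 i hi).symm
  let f := Finset.equivOfCardEq hcard
  refine ⟨fun i => if h : i ∈ a.support then single (f ⟨i, h⟩ : ℕ) 1 else single 0 1,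
    fun i => ?_, ?_⟩
  · dsimp only
    split_ifs <;> simp
  · rw [Finsupp.linearCombination_apply, Finsupp.sum, linearVec, ← Finset.sum_coe_sort,
      ← Finset.sum_coe_sort (Finset.range a.degree)]
    refine Fintype.sum_equiv f _ _ fun i => ?_
    rw [dif_pos i.2, h1 i i.2, one_smul]

theorem apply_add_apply_le_degree {i j : ℕ} (hij : i ≠ j) (a : ℕ →₀ ℕ) :
    a i + a j ≤ a.degree := by
  rw [← apply_add_degree_erase i, ← apply_add_degree_erase (a := a.erase i) j,
    Finsupp.erase_ne hij.symm]
  omega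

/-- Incomparable vectors with the same support that are congruent modulo `m` have degree at
least `m + 2`. -/
theorem add_two_le_degree {a b : ℕ →₀ ℕ} {m : ℕ} (hs : a.support = b.support) (hab : ¬ a ≤ b)
    (hba : ¬ b ≤ a) (hm : ∀ i, a i ≡ b i [MOD m]) : m + 2 ≤ a.degree := by
  rw [Finsupp.le_def] at hab hba
  push Not at hab hba
  obtain ⟨i, hi⟩ := hab
  obtain ⟨j, hj⟩ := hba
  have hs' : ∀ i, a i ≠ 0 ↔ b i ≠ 0 := fun i => by
    rw [← Finsupp.mem_support_iff, ← Finsupp.mem_support_iff, hs]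
  have hij : i ≠ j := by
    rintro rfl
    omega
  have h1 := apply_add_apply_le_degree hij a
  have h2 := Nat.le_of_dvd (by omega) ((Nat.modEq_iff_dvd' hi.le).1 (hm i).symm)
  have h3 := hs' i
  have h4 := hs' j
  omega

theorem exists_two_le {a b : ℕ →₀ ℕ} (hs : a.support = b.support) (hle : ¬ a ≤ b) :
    ∃ i, 2 ≤ a i := by
  by_contra! hcon
  refine hle fun i => ?_
  have h1 := hcon i
  have h2 : a i ≠ 0 ↔ b i ≠ 0 := by
    rw [← Finsupp.mem_support_iff, ← Finsupp.mem_support_iff, hs]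
  omega

namespace ComVariety

variable {V W C : ComVariety} {a b c e : ℕ →₀ ℕ} {k m n : ℕ}

theorem IsZero.ne_zero (h : V.IsZero a) : a ≠ 0 := (h 0).ne_zero_left

theorem IsZero.rel (ha : V.IsZero a) (hb : V.IsZero b) : V.Rel a b := by
  refine (ha b).trans ?_
  rw [add_comm]
  exact (hb a).symm

theorem IsZero.add_right (ha : V.IsZero a) (c : ℕ →₀ ℕ) : V.IsZero (a + c) := fun d => by
  rw [add_assoc]
  exact (ha c).symm.trans (ha (c + d))

theorem IsZero.of_rel (ha : V.IsZero a) (h : V.Rel a b) : V.IsZero b := fun c =>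
  h.symm.trans ((ha c).trans (h.add_right c))

theorem IsZero.mono (ha : W.IsZero a) (h : V ≤ W) : V.IsZero a := fun c => le_iff_rel.1 h _ _ (ha c)

theorem IsZero.subst (ha : V.IsZero a) {σ : ℕ → ℕ →₀ ℕ} (hσ : ∀ i, σ i ≠ 0) :
    V.IsZero (linearCombination ℕ σ a) := by
  intro c
  obtain ⟨i, hi⟩ := Infinite.exists_notMem_finset a.support
  have hi : a i = 0 := Finsupp.notMem_support_iff.1 hi
  rcases eq_or_ne c 0 with rfl | hc
  · rw [add_zero]
    exact Rel.refl ((ha 0).subst hσ).ne_zero_left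
  have h := (ha (single i 1)).subst (update_ne_zero hσ i hc)
  rwa [map_add, linearCombination_update, hi, zero_smul, zero_add, erase_eq_self hi,
    Finsupp.linearCombination_single, Function.update_self, one_smul] at h

theorem IsNil.exists_isZero_smul (h : V.IsNil) (hc : c ≠ 0) : ∃ s : ℕ, V.IsZero (s • c) := by
  obtain ⟨s, hs⟩ := h
  refine ⟨s, ?_⟩
  simpa [Finsupp.linearCombination_single] using hs.subst (σ := fun _ => c) fun _ => hc

theorem IsNil.mono (h : W.IsNil) (hVW : V ≤ W) : V.IsNil := h.imp fun _ hs => hs.mono hVW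

theorem IsNil.isZero_of_rel_add (h : V.IsNil) (hc : c ≠ 0) (hac : V.Rel a (a + c)) :
    V.IsZero a := by
  have key : ∀ s : ℕ, V.Rel a (a + s • c) := by
    intro s
    induction s with
    | zero => simpa using Rel.refl hac.ne_zero_left
    | succ s ih =>
      refine ih.trans ?_
      have := hac.add_right (s • c)
      rwa [add_assoc a c, ← succ_nsmul'] at this
  obtain ⟨s, hs⟩ := h.exists_isZero_smul hc
  have := hs.add_right a
  rw [add_comm] at this
  exact this.of_rel (key s).symm

theorem IsNil.isZero_of_le (h : V.IsNil) (hab : V.Rel a b) (hle : a ≤ b) (hne : a ≠ b) :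
    V.IsZero a := by
  obtain ⟨c, rfl⟩ := exists_add_of_le hle
  exact h.isZero_of_rel_add (by rintro rfl; simp at hne) hab

theorem IsNil.isZero_of_apply_eq_zero (h : V.IsNil) (hab : V.Rel a b) {i : ℕ} (ha : a i ≠ 0)
    (hb : b i = 0) : V.IsZero a := by
  have h1 := hab.subst (update_ne_zero (σ := fun j => single j 1) (by simp) i
    (c := single i 2) (by simp))
  rw [linearCombination_update, linearCombination_update, hb, zero_smul, zero_add,
    erase_eq_self hb, linearCombination_single_one, linearCombination_single_one] at h1
  have h2 := hab.trans h1.symm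
  have h3 : a i • single i 2 + a.erase i = a + single i (a i) := by
    conv_rhs => rw [← Finsupp.single_add_erase i a]
    rw [add_right_comm, ← Finsupp.single_add, Finsupp.smul_single, smul_eq_mul]
    simp [mul_two]
  rw [h3] at h2
  exact h.isZero_of_rel_add (by simpa) h2

/-- In a nil variety, the two sides of a nontrivial identity are both zero, or incomparable
with the same letters. -/
theorem IsNil.isZero_or_incomparable (h : V.IsNil) (hab : V.Rel a b) (hne : a ≠ b) :
    (V.IsZero a ∧ V.IsZero b) ∨ (a.support = b.support ∧ ¬ a ≤ b ∧ ¬ b ≤ a) := by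
  by_cases ha : V.IsZero a
  · exact .inl ⟨ha, ha.of_rel hab⟩
  right
  have hb : ¬ V.IsZero b := fun hb => ha (hb.of_rel hab.symm)
  refine ⟨?_, fun hle => ha (h.isZero_of_le hab hle hne),
    fun hle => hb (h.isZero_of_le hab.symm hle hne.symm)⟩
  ext i
  rw [Finsupp.mem_support_iff, Finsupp.mem_support_iff]
  constructor
  · exact fun hai hbi => ha (h.isZero_of_apply_eq_zero hab hai hbi)
  · exact fun hbi hai => hb (h.isZero_of_apply_eq_zero hab.symm hbi hai)

theorem IsZero.of_linearVec (h : V.IsZero (linearVec k)) (ha : k ≤ a.degree) : V.IsZero a := by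
  obtain ⟨σ, hσ, c, rfl⟩ := exists_subst_linearVec k a ha
  exact (h.subst hσ).add_right c

theorem IsZero.linearVec (h : V.IsZero a) (ha : ∀ i, a i ≤ 1) (hk : a.degree ≤ k) :
    V.IsZero (linearVec k) := by
  obtain ⟨σ, hσ, hL⟩ := exists_subst_eq_linearVec ha
  have h1 := h.subst hσ
  rw [hL] at h1
  exact h1.of_linearVec (by rwa [degree_linearVec])

theorem IsZero.of_sq (h : V.IsZero (single 0 2)) {i : ℕ} (hi : 2 ≤ a i) : V.IsZero a := by
  have h1 := h.subst (σ := fun _ => single i 1) (by simp)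
  have h2 := h1.add_right (a - single i 2)
  rw [Finsupp.linearCombination_single, Finsupp.smul_single, smul_eq_mul, mul_one,
    add_tsub_cancel_of_le (Finsupp.single_le_iff.2 hi)] at h2
  exact h2

theorem IsZero.sq (h : V.IsZero a) (ha : a.degree ≤ 2) : V.IsZero (single 0 2) := by
  have h1 := h.subst (σ := fun _ => single 0 1) (by simp)
  rw [linearCombination_const (c := single 0 1) fun _ _ => rfl] at h1
  have h2 := h1.add_right (single 0 (2 - a.degree))
  rwa [Finsupp.smul_single, smul_eq_mul, mul_one, ← Finsupp.single_add,
    Nat.add_sub_cancel' ha] at h2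

theorem sqfVariety_le (h : V.IsNil) (hk : ¬ V.IsZero (linearVec k)) : sqfVariety (k + 1) ≤ V := by
  refine le_iff_rel.2 fun a b hab => rel_sqfVariety.2 ⟨hab.ne_zero_left, hab.ne_zero_right, ?_⟩
  rcases eq_or_ne a b with rfl | hne
  · exact .inl rfl
  right
  rcases h.isZero_or_incomparable hab hne with ⟨ha, hb⟩ | ⟨hs, hle, hge⟩
  · have key : ∀ a, V.IsZero a → k + 1 ≤ a.degree ∨ ∃ i, 2 ≤ a i := by
      intro a ha
      by_contra! hcon
      exact hk (ha.linearVec (fun i => Nat.le_of_lt_succ (hcon.2 i)) (by omega))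
    exact ⟨key a ha, key b hb⟩
  · exact ⟨.inr (exists_two_le hs hle), .inr (exists_two_le hs.symm hge)⟩

theorem isZero_sqfVariety_sq (k : ℕ) : (sqfVariety k).IsZero (single 0 2) := fun c =>
  rel_sqfVariety.2 ⟨by simp, by simp, .inr ⟨.inr ⟨0, by simp⟩, .inr ⟨0, by simp⟩⟩⟩

theorem isZero_sqfVariety (ha : a ≠ 0) (hk : k ≤ a.degree) : (sqfVariety k).IsZero a := fun c =>
  rel_sqfVariety.2 ⟨ha, by simp [ha], .inr ⟨.inl hk, .inl (by rw [map_add]; omega)⟩⟩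

theorem sqfVariety_mono : Monotone sqfVariety := fun j k h => le_iff_rel.2 fun a b hab => by
  rw [rel_sqfVariety] at hab ⊢
  exact ⟨hab.1, hab.2.1, hab.2.2.imp_right
    (And.imp (Or.imp_left h.trans) (Or.imp_left h.trans))⟩

theorem exists_eq_sqfVariety (h : V ≤ sqfVariety k) : ∃ j, V = sqfVariety j := by
  classical
  have hsq : V.IsZero (single 0 2) := (isZero_sqfVariety_sq k).mono h
  have hex : ∃ j, V.IsZero (linearVec j) := ⟨k + 1, (isZero_sqfVariety
    (linearVec_ne_zero k.succ_ne_zero) (by rw [degree_linearVec]; omega)).mono h⟩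
  have hfind := Nat.find_spec hex
  have hmin := fun l hl => Nat.find_min (m := l) hex hl
  generalize Nat.find hex = j at hfind hmin
  obtain ⟨j, rfl⟩ : ∃ l, j = l + 1 := Nat.exists_eq_succ_of_ne_zero fun h0 => by
    rw [h0] at hfind
    exact hfind.ne_zero rfl
  refine ⟨j + 1, le_antisymm (le_iff_rel.2 fun a b hab => ?_)
    (sqfVariety_le ((isNil_sqfVariety k).mono h) (hmin j j.lt_succ_self))⟩
  obtain ⟨ha, hb, rfl | ⟨h1, h2⟩⟩ := rel_sqfVariety.1 hab
  · exact Rel.refl ha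
  · have key : ∀ a : ℕ →₀ ℕ, (j + 1 ≤ a.degree ∨ ∃ i, 2 ≤ a i) → V.IsZero a := by
      rintro a (h | ⟨i, hi⟩)
      · exact hfind.of_linearVec h
      · exact hsq.of_sq hi
    exact (key a h1).rel (key b h2)

theorem nilChain_sqfVariety (k : ℕ) : NilChain (sqfVariety k) := by
  refine ⟨nilLike_iff.2 (isNil_sqfVariety k), fun v hv w hw => ?_⟩
  obtain ⟨i, rfl⟩ := exists_eq_sqfVariety hv
  obtain ⟨j, rfl⟩ := exists_eq_sqfVariety hw
  exact (le_total i j).imp (@sqfVariety_mono _ _) (@sqfVariety_mono _ _)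

theorem heightGE_sqfVariety (k : ℕ) : HeightGE k (sqfVariety (k + 1)) := by
  induction k with
  | zero => trivial
  | succ k ih =>
    refine ⟨sqfVariety (k + 1), fun h => ?_, sqfVariety_mono (Nat.le_succ _), ih⟩
    exact not_isZero_sqfVariety (k + 1) ((isZero_sqfVariety (linearVec_ne_zero k.succ_ne_zero)
      (degree_linearVec _).ge).mono h)

theorem heightGE_antitone {j : ℕ} (hjk : j ≤ k) (h : HeightGE k V) : HeightGE j V := by
  induction k generalizing j V with
  | zero =>
    obtain rfl := Nat.le_zero.1 hjk
    trivial
  | succ k ih =>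
    cases j with
    | zero => trivial
    | succ j =>
      obtain ⟨y, h1, h2, h3⟩ := h
      exact ⟨y, h1, h2, ih (Nat.le_of_succ_le_succ hjk) h3⟩

/-- A sequence of words controlling the heights of subvarieties of a nil variety. -/
theorem not_isZero_of_heightGE (hC : C.IsNil) {w : ℕ → ℕ →₀ ℕ} (h0 : w 0 = 0)
    (hinc : ∀ a b : ℕ →₀ ℕ, a.support = b.support → ¬ a ≤ b → ¬ b ≤ a → C.IsZero a)
    (hstep : ∀ j a, (∀ U ≤ C, U.IsZero a → U.IsZero (w j)) ∨
      ∀ U ≤ C, U.IsZero (w (j + 1)) → U.IsZero a)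
    (hW : W ≤ C) (hk : HeightGE k W) : ¬ W.IsZero (w k) := by
  induction k generalizing W with
  | zero => exact fun h => h.ne_zero h0
  | succ k ih =>
    obtain ⟨y, h1, h2, h3⟩ := hk
    have hy := ih (h2.trans hW) h3
    refine fun hz => h1 (le_iff_rel.2 fun a b hab => ?_)
    rcases eq_or_ne a b with rfl | hne
    · exact Rel.refl hab.ne_zero_left
    rcases (hC.mono (h2.trans hW)).isZero_or_incomparable hab hne with ⟨ha, hb⟩ | ⟨hs, hle, hge⟩
    · have key : ∀ a, y.IsZero a → W.IsZero a := fun a ha =>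
        (hstep k a).elim (fun h => absurd (h y (h2.trans hW) ha) hy) fun h => h W hW hz
      exact (key a ha).rel (key b hb)
    · exact ((hinc a b hs hle hge).mono hW).rel ((hinc b a hs.symm hge hle).mono hW)

theorem three_le_degree {a b : ℕ →₀ ℕ} (hs : a.support = b.support) (hle : ¬ a ≤ b)
    (hge : ¬ b ≤ a) : 3 ≤ a.degree :=
  add_two_le_degree hs hle hge fun _ => Nat.modEq_one

theorem nilpVariety_three_le (hC : C.IsNil) (hsq : ¬ C.IsZero (single 0 2)) :
    nilpVariety 3 ≤ C := by
  refine le_iff_rel.2 fun a b hab => rel_nilpVariety.2 ⟨hab.ne_zero_left, hab.ne_zero_right, ?_⟩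
  rcases eq_or_ne a b with rfl | hne
  · exact .inl rfl
  right
  rcases hC.isZero_or_incomparable hab hne with ⟨ha, hb⟩ | ⟨hs, hle, hge⟩
  · have key : ∀ a, C.IsZero a → 3 ≤ a.degree := fun a ha => by
      by_contra hlt
      exact hsq (ha.sq (by omega))
    exact ⟨key a ha, key b hb⟩
  · exact ⟨three_le_degree hs hle hge, three_le_degree hs.symm hge hle⟩

/-- The words controlling heights below a nil variety satisfying `xyz = 0`. -/
noncomputable def shortWord : ℕ → ℕ →₀ ℕ
  | 0 => 0
  | 1 => linearVec 1
  | 2 => linearVec 2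
  | 3 => single 0 2
  | _ + 4 => linearVec 3

theorem not_heightGE_four (hC : C.IsNil) (h3 : C.IsZero (linearVec 3)) : ¬ HeightGE 4 C := by
  refine fun hk => not_isZero_of_heightGE (w := shortWord) hC rfl
    (fun a b hs hle hge => h3.of_linearVec (three_le_degree hs hle hge)) ?_ le_rfl hk h3
  intro j a
  by_cases hlong : 3 ≤ a.degree
  · exact .inr fun U hU _ => (h3.of_linearVec hlong).mono hU
  match j with
  | 0 =>
    rcases eq_or_ne a 0 with rfl | ha
    · exact .inl fun U _ h => absurd rfl h.ne_zero
    · exact .inr fun U _ h => h.of_linearVec (one_le_degree ha)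
  | 1 =>
    by_cases h2 : 2 ≤ a.degree
    · exact .inr fun U _ h => h.of_linearVec h2
    · refine .inl fun U _ h => h.linearVec (fun i => ?_) (by omega)
      have := apply_add_degree_erase (a := a) i
      omega
  | 2 =>
    by_cases hsq : ∃ i, 2 ≤ a i
    · obtain ⟨i, hi⟩ := hsq
      exact .inr fun U _ h => IsZero.of_sq h hi
    · push Not at hsq
      exact .inl fun U _ h => h.linearVec (fun i => Nat.le_of_lt_succ (hsq i)) (by omega)
  | 3 => exact .inl fun U _ h => h.sq (by omega)
  | _ + 4 => exact .inl fun U hU _ => h3.mono hU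

theorem not_isZero_linearVec_of_nilChain (hC : NilChain C) (hk : 4 ≤ k) (h : HeightGE k C) :
    ¬ C.IsZero (linearVec k) := by
  obtain ⟨hnil, hchain⟩ := hC
  rw [nilLike_iff] at hnil
  by_cases hsq : C.IsZero (single 0 2)
  · refine not_isZero_of_heightGE (w := linearVec) hnil rfl (fun a b hs hle _ => ?_)
      (fun j a => ?_) le_rfl h
    · obtain ⟨i, hi⟩ := exists_two_le hs hle
      exact hsq.of_sq hi
    · by_cases h2 : ∃ i, 2 ≤ a i
      · obtain ⟨i, hi⟩ := h2
        exact .inr fun U hU _ => (hsq.mono hU).of_sq hi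
      · push Not at h2
        rcases le_or_gt a.degree j with hj | hj
        · exact .inl fun U _ h => h.linearVec (fun i => Nat.le_of_lt_succ (h2 i)) hj
        · exact .inr fun U _ h => h.of_linearVec hj
  · refine absurd (heightGE_antitone hk h) (not_heightGE_four hnil ?_)
    by_contra h3
    rcases hchain _ (sqfVariety_le hnil h3) _ (nilpVariety_three_le hnil hsq) with h' | h'
    · exact not_sqf_le_nilp_three h'
    · exact not_nilp_three_le_sqf 4 h'

/-! ### The exponent of a group variety -/

theorem add_three_le_of_exponentLT (h : ExponentLT k (modVariety m)) :
    m + 3 ≤ k := by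
  obtain ⟨y, hy, z, hz, hchain, hle, g, hg, hzg⟩ := h
  rw [nilLike_iff] at hy hz
  obtain ⟨q, hq, rfl⟩ := abGroupLike_iff.1 hg
  have hzk : z.IsZero (linearVec k) := by
    by_contra hzk
    exact hchain _ (nilChain_sqfVariety _) (heightGE_sqfVariety k) (sqfVariety_le hz hzk)
  obtain ⟨a, b, hab, hnz⟩ := not_le_iff_rel.1 hle
  rw [rel_sup] at hab
  have hne : a ≠ b := by
    rintro rfl
    exact hnz (Rel.refl hab.2.ne_zero_left)
  have hzero : ∀ a, y.IsZero a → z.IsZero a := by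
    intro a ha
    refine hz.isZero_of_rel_add (c := q • single 0 1) (by simp; omega)
      (le_iff_rel.1 hzg _ _ (rel_sup.2 ⟨rel_modVariety.2 ⟨ha.ne_zero, by simp [ha.ne_zero],
        fun i => ?_⟩, ha _⟩))
    rw [Nat.ModEq, Finsupp.add_apply, Finsupp.smul_apply, smul_eq_mul, Nat.add_mul_mod_self_left]
  rcases hy.isZero_or_incomparable hab.2 hne with ⟨ha, hb⟩ | ⟨hs, hle, hge⟩
  · exact absurd ((hzero a ha).rel (hzero b hb)) hnz
  · have hmod := (rel_modVariety.1 hab.1).2.2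
    have h1 := add_two_le_degree hs hle hge hmod
    have h2 := add_two_le_degree hs.symm hge hle fun i => (hmod i).symm
    by_contra hk
    exact hnz ((hzk.of_linearVec (by omega)).rel (hzk.of_linearVec (by omega)))

theorem isNil_swapVariety (k : ℕ) : (swapVariety k).IsNil :=
  ⟨k + 1, fun c => rel_swapVariety.2 ⟨by simp, by simp,
    .inr (.inl ⟨by simp, by rw [map_add, Finsupp.degree_single]; omega⟩)⟩⟩

theorem exponentLT_modVariety (hm : 1 ≤ m) (hmk : m + 3 ≤ k) :
    ExponentLT k (modVariety m) := by
  refine ⟨swapVariety (m + 2), nilLike_iff.2 (isNil_swapVariety _), nilpVariety (m + 3),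
    nilLike_iff.2 (isNil_nilpVariety _), fun C hC hk hle => ?_, ?_, modVariety (m + 3),
    abGroupLike_iff.2 ⟨_, by omega, rfl⟩, ?_⟩
  · exact not_isZero_linearVec_of_nilChain hC (by omega) hk
      ((isZero_nilpVariety (linearVec_ne_zero (by omega))
        (by rwa [degree_linearVec])).mono hle)
  · refine not_le_iff_rel.2 ⟨single 0 (m + 1) + single 1 1, single 0 1 + single 1 (m + 1),
      rel_sup.2 ⟨rel_modVariety.2 ⟨by simp, by simp, fun i => ?_⟩,
        rel_swapVariety.2 ⟨by simp, by simp, .inr (.inr ⟨?_, ?_, ?_⟩)⟩⟩, fun h => ?_⟩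
    · rcases eq_or_ne i 0 with rfl | h0
      · simp [Nat.ModEq]
      rcases eq_or_ne i 1 with rfl | h1
      · simp [Nat.ModEq]
      · simp [h0, h1, Nat.ModEq]
    · simp
    · simp
      omega
    · ext i
      rcases eq_or_ne i 0 with rfl | h0
      · simp
      rcases eq_or_ne i 1 with rfl | h1
      · simp
      · simp [h0, h1]
    · rcases (rel_nilpVariety.1 h).2.2 with h | h
      · have := DFunLike.congr_fun h 0
        simp at this
        omega
      · simp at h
  · refine le_iff_rel.2 fun a b hab => ?_
    obtain ⟨h1, h2⟩ := rel_sup.1 hab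
    obtain ⟨ha, hb, h1⟩ := rel_modVariety.1 h1
    refine rel_nilpVariety.2 ⟨ha, hb, ?_⟩
    rcases (rel_swapVariety.1 h2).2.2 with rfl | h2 | ⟨h2, h3, -⟩
    · exact .inl rfl
    · exact .inr h2
    · left
      ext i
      have h4 := apply_add_degree_erase (a := a) i
      have h5 := apply_add_degree_erase (a := b) i
      exact Nat.ModEq.eq_of_lt_of_lt (h1 i) (by omega) (by omega)

theorem eq_modVariety_iff (hn : 1 ≤ n) : V = modVariety n ↔
    AbGroupLike V ∧ ExponentLT (n + 3) V ∧ ¬ ExponentLT (n + 2) V := by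
  constructor
  · rintro rfl
    refine ⟨abGroupLike_iff.2 ⟨n, hn, rfl⟩, exponentLT_modVariety hn le_rfl, fun h => ?_⟩
    have := add_three_le_of_exponentLT h
    omega
  · rintro ⟨hV, h1, h2⟩
    obtain ⟨m, hm, rfl⟩ := abGroupLike_iff.1 hV
    have h3 := add_three_le_of_exponentLT h1
    rcases (show m = n ∨ m < n by omega) with rfl | hlt
    · rfl
    · exact absurd (exponentLT_modVariety hm (by omega)) h2

end ComVariety

theorem latDefinable_modVariety {n : ℕ} (hn : 1 ≤ n) :
    LatDefinable ComVariety {W : ComVariety | W = modVariety n} := by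
  obtain ⟨φ, hφ⟩ := ((fodef_abGroupLike (L := ComVariety)).and
    ((fodef_exponentLT (n + 3)).and (fodef_exponentLT (n + 2)).not)).congr fun v =>
      (ComVariety.eq_modVariety_iff (V := v 0) hn).symm
  exact ⟨φ, fun a => hφ _⟩

/-! ### Group varieties -/

theorem IsGroupSG.cancel {S : Type} [Semigroup S] (h : IsGroupSG S) {a b c : S}
    (habc : a * c = b * c) : a = b := by
  obtain ⟨e, he, hinv⟩ := h
  obtain ⟨d, hd, -⟩ := hinv c
  rw [← (he a).2, ← (he b).2, ← hd, ← mul_assoc, ← mul_assoc, habc]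

theorem IsFullyInvariant.cancel {r : (ℕ →₀ ℕ) → (ℕ →₀ ℕ) → Prop} (hr : IsFullyInvariant r)
    {V : ComVariety} (hV : IsGroupVariety V) (hle : hr.toVariety ≤ V) {a b c : ℕ →₀ ℕ}
    (ha : a ≠ 0) (hb : b ≠ 0) (hc : c ≠ 0) (h : r (a + c) (b + c)) : r a b := by
  obtain ⟨u, rfl⟩ := exists_expVec_eq ha
  obtain ⟨v, rfl⟩ := exists_expVec_eq hb
  obtain ⟨w, rfl⟩ := exists_expVec_eq hc
  rw [← expVec_mul, ← expVec_mul] at h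
  refine hr.satisfies_freeModel.1 fun f => ?_
  have h1 := hV hr.freeModel fun i hi => hr.satisfies_freeModel.2 (hle hi)
  have h2 := hr.satisfies_freeModel.2 h f
  rw [map_mul, map_mul] at h2
  exact h1.cancel h2

theorem IsGroupVariety.exists_eq_modVariety {V : ComVariety} (hV : IsGroupVariety V) :
    ∃ n, 1 ≤ n ∧ V = modVariety n := by
  refine ComVariety.exists_eq_modVariety (fun h => ?_) fun h => ?_
  · have h1 := isFullyInvariant_support.cancel hV h (a := single 0 1) (b := single 1 1)
      (c := single 0 1 + single 1 1) (by simp) (by simp) (by simp) (by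
        ext i
        rcases eq_or_ne i 0 with rfl | h0
        · simp
        rcases eq_or_ne i 1 with rfl | h1
        · simp
        · simp [h0, h1])
    have h2 := Finset.ext_iff.1 h1 0
    simp at h2
  · have h1 := (isFullyInvariant_degree 2).cancel hV h (a := single 0 1) (b := single 1 1)
      (c := single 0 1) (by simp) (by simp) (by simp) (.inr ⟨by simp, by simp⟩)
    rcases h1 with h1 | h1
    · have h2 := DFunLike.congr_fun h1 0
      simp at h2
    · simp at h1

theorem expVec_wpow (w : SGWord) (n : ℕ) : expVec (wpow w (n + 1)) = (n + 1) • expVec w := by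
  induction n with
  | zero => simp [wpow]
  | succ n ih => rw [wpow, expVec_mul, ih, succ_nsmul _ (n + 1)]

theorem Avar_eq_modVariety {n : ℕ} (hn : 1 ≤ n) : Avar n = modVariety n := by
  obtain ⟨n, rfl⟩ : ∃ m, n = m + 1 := ⟨n - 1, by omega⟩
  have hexp : expVec (wpow (ltr 0) (n + 1) * ltr 1) = single 0 (n + 1) + single 1 1 := by
    rw [expVec_mul, expVec_wpow, ltr, ltr, expVec_of, expVec_of, Finsupp.smul_single, smul_eq_mul,
      mul_one]
  have hrel : (Avar (n + 1)).Rel (single 0 (n + 1) + single 1 1) (single 1 1) := by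
    rw [← hexp, ← expVec_of, ComVariety.rel_expVec]
    exact subset_theoryOfClass_modelsOf _ (.inl rfl)
  have hle : modVariety (n + 1) ≤ Avar (n + 1) := by
    intro i hi
    refine (isFullyInvariant_modEq (n + 1)).satisfies_freeModel.1 (hi _ fun j hj => ?_)
    refine (isFullyInvariant_modEq (n + 1)).satisfies_freeModel.2 fun l => ?_
    rcases hj with rfl | rfl
    · simp only [hexp, show expVec (ltr 1) = single 1 1 from expVec_of 1]
      rcases eq_or_ne l 0 with rfl | h0
      · simp [Nat.ModEq]
      · simp [h0, Nat.ModEq]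
    · simp only [commId, expVec_mul]
      rw [add_comm (expVec (ltr 1))]
  refine le_antisymm ?_ hle
  have hsl : ¬ slVariety ≤ Avar (n + 1) := fun h => by
    have h2 := Finset.ext_iff.1
      (ComVariety.rel_slVariety.1 (ComVariety.le_iff_rel.1 h _ _ hrel)).2.2 0
    simp at h2
  have hzm : ¬ ComVariety.zmVariety ≤ Avar (n + 1) := fun h => by
    rcases (ComVariety.rel_nilpVariety.1 (ComVariety.le_iff_rel.1 h _ _ hrel)).2.2 with h | h
    · have h2 := DFunLike.congr_fun h 0
      simp at h2
    · simp at h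
  obtain ⟨m, -, hm⟩ := ComVariety.exists_eq_modVariety hsl hzm
  rw [hm] at hrel ⊢
  refine ComVariety.modVariety_le_of_dvd (Nat.modEq_zero_iff_dvd.1 ?_)
  simpa using (ComVariety.rel_modVariety.1 hrel).2.2 0

/-- **Theorem.** Every Abelian periodic group variety is definable in the lattice
**Com**; in particular, for every natural number `n > 1` the variety `A n` of Abelian
groups whose exponent divides `n` is a definable element of **Com**.  (Every member of
a commutative semigroup variety is commutative, so "Abelian" is automatic here.) -/
theorem definable_abelian_periodic_group_varieties :
    (∀ V : ComVariety, IsGroupVariety V → IsPeriodicVariety V →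
      LatDefinable ComVariety {W : ComVariety | W = V}) ∧
    (∀ n : ℕ, 1 < n → LatDefinable ComVariety {W : ComVariety | W = Avar n}) := by
  refine ⟨fun V hV _ => ?_, fun n hn => ?_⟩
  · obtain ⟨n, hn, rfl⟩ := hV.exists_eq_modVariety
    exact latDefinable_modVariety hn
  · rw [Avar_eq_modVariety hn.le]
    exact latDefinable_modVariety hn.le
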